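/- Let G = ([n], E) be a minimally 2-rigid graph with n ≥ 3 vertices, labelled so that 12 ∈ E. In the parametrised Laurent polynomial ring with parameters a_{ij} (ij ∈ E, i < j) and c_{1,1}, c_{1,2}, and Laurent variables y_{ij} (ij ∈ E, i < j), with the convention y_{st} := −y_{ts} for s > t, let I″_E be the ideal generated by h″_{C,1} := Σ_{(i,j)∈C} y_{ij} and h″_{C,2} := Σ_{(i,j)∈C} a_{ij} y_{ij}^{−1} for each directed cycle C of G, together with g″_{12} := c_{1,1} y_{12}² + c_{1,2}. Then the generic root count ℓ_{I″_E, ℂ(a,c)} equals 4 · c₂(G). -/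

import Mathlib

open scoped BigOperators

set_option synthInstance.maxHeartbeats 1000000
set_option maxHeartbeats 1000000

noncomputable section

namespace PaperDefs

/-- Two complex realisations are congruent if they differ by a complex orthogonal
transformation followed by a translation. -/
def Congruent {n d : ℕ} (p q : Fin n → Fin d → ℂ) : Prop :=
  ∃ (A : Matrix (Fin d) (Fin d) ℂ) (x : Fin d → ℂ),
    A * A.transpose = 1 ∧ A.transpose * A = 1 ∧ ∀ i, p i = A.mulVec (q i) + x

/-- Two real realisations are congruent if they differ by an isometry of `ℝ^d`. -/
def RealCongruent {n d : ℕ} (p q : Fin n → Fin d → ℝ) : Prop :=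
  ∃ (A : Matrix (Fin d) (Fin d) ℝ) (x : Fin d → ℝ),
    A * A.transpose = 1 ∧ A.transpose * A = 1 ∧ ∀ i, p i = A.mulVec (q i) + x

/-- The complex rigidity map `f_{G,d}`, recording half the squared edge lengths. -/
def rigidityMap {n : ℕ} (G : SimpleGraph (Fin n)) (d : ℕ)
    (p : Fin n → Fin d → ℂ) : G.edgeSet → ℂ :=
  fun e => Sym2.lift ⟨fun i j => (2⁻¹ : ℂ) * ∑ k, (p i k - p j k) ^ 2,
    fun i j => by
      have h : ∀ k, (p i k - p j k) ^ 2 = (p j k - p i k) ^ 2 := fun k => by ring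
      simp only [h]⟩ (e : Sym2 (Fin n))

/-- A real framework `(G,p)` is rigid: every continuous edge-length-preserving motion
starting at `p` stays congruent to `p`. -/
def IsRigidFramework {n : ℕ} (G : SimpleGraph (Fin n)) (d : ℕ)
    (p : Fin n → Fin d → ℝ) : Prop :=
  ∀ q : ℝ → Fin n → Fin d → ℝ,
    ContinuousOn q (Set.Icc 0 1) → q 0 = p →
    (∀ t ∈ Set.Icc (0 : ℝ) 1, ∀ i j, G.Adj i j →
        ∑ k, (q t i k - q t j k) ^ 2 = ∑ k, (p i k - p j k) ^ 2) →
    ∀ t ∈ Set.Icc (0 : ℝ) 1, RealCongruent (q t) p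

/-- `G` is `d`-rigid: generic real realisations give rigid frameworks. -/
def IsRigidGraph {n : ℕ} (G : SimpleGraph (Fin n)) (d : ℕ) : Prop :=
  ∃ f : MvPolynomial (Fin n × Fin d) ℝ, f ≠ 0 ∧
    ∀ p : Fin n → Fin d → ℝ,
      MvPolynomial.eval (fun v => p v.1 v.2) f ≠ 0 → IsRigidFramework G d p

/-- `G` is minimally `d`-rigid. -/
def IsMinimallyRigidGraph {n : ℕ} (G : SimpleGraph (Fin n)) (d : ℕ) : Prop :=
  IsRigidGraph G d ∧ ∀ e ∈ G.edgeSet, ¬ IsRigidGraph (G.deleteEdges {e}) d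

/-- The set of congruence classes of a set of complex realisations. -/
def congClasses {n d : ℕ} (S : Set (Fin n → Fin d → ℂ)) :
    Set (Set (Fin n → Fin d → ℂ)) :=
  (fun q => {q' ∈ S | Congruent q q'}) '' S

/-- `c` is the `d`-realisation number of `G`: for generic complex `p` the fibre of the
rigidity map through `p` has exactly `c` congruence classes. -/
def IsRealisationNumber {n : ℕ} (G : SimpleGraph (Fin n)) (d : ℕ) (c : ℕ) : Prop :=
  0 < c ∧ ∃ f : MvPolynomial (Fin n × Fin d) ℂ, f ≠ 0 ∧
    ∀ p : Fin n → Fin d → ℂ,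
      MvPolynomial.eval (fun v => p v.1 v.2) f ≠ 0 →
        (congClasses {q | rigidityMap G d q = rigidityMap G d p}).ncard = c

/-- The Zariski closure of the image of the rigidity map `f_{G,d}`. -/
def rigidityImageClosure {n : ℕ} (G : SimpleGraph (Fin n)) (d : ℕ) :
    Set (G.edgeSet → ℂ) :=
  {lam | ∀ f : MvPolynomial G.edgeSet ℂ,
    (∀ p, MvPolynomial.eval (rigidityMap G d p) f = 0) → MvPolynomial.eval lam f = 0}

/-- The Laurent polynomial ring over `K` in variables indexed by `V`, realised as the
group algebra of the free abelian group on `V`. -/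
abbrev LaurentRing (K : Type*) [CommRing K] (V : Type*) : Type _ :=
  AddMonoidAlgebra K (V →₀ ℤ)

/-- The Laurent variable `x_v`. -/
def LX {K : Type*} [CommRing K] {V : Type*} (v : V) : LaurentRing K V :=
  AddMonoidAlgebra.single (Finsupp.single v 1) 1

/-- The inverse Laurent variable `x_v⁻¹`. -/
def LXinv {K : Type*} [CommRing K] {V : Type*} (v : V) : LaurentRing K V :=
  AddMonoidAlgebra.single (Finsupp.single v (-1)) 1

/-- The field of rational functions `ℂ(a)` in parameters indexed by `P`. -/
abbrev RatFuncField (P : Type*) : Type _ := FractionRing (MvPolynomial P ℂ)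

/-- The parameter `a_p` as an element of `ℂ(a)`. -/
def ratParam {P : Type*} (p : P) : RatFuncField P :=
  algebraMap (MvPolynomial P ℂ) (RatFuncField P) (MvPolynomial.X p)

/-- The signed Laurent variable `y_{st,k}` attached to a dart (directed edge) of `G`:
it is `y_{e,k}` if the dart is increasingly oriented and `-y_{e,k}` otherwise, where `e`
is the underlying undirected edge. -/
def ydir {n : ℕ} {G : SimpleGraph (Fin n)} (K : Type*) [CommRing K] {d : ℕ}
    (dd : G.Dart) (k : Fin d) : LaurentRing K (↥G.edgeSet × Fin d) :=
  if dd.toProd.1 < dd.toProd.2 then LX (⟨dd.edge, dd.edge_mem⟩, k)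
  else - LX (⟨dd.edge, dd.edge_mem⟩, k)

/-- The signed Laurent variable `y_{st}` attached to a dart of `G` (single-variable
version). -/
def ydirE {n : ℕ} {G : SimpleGraph (Fin n)} (K : Type*) [CommRing K]
    (dd : G.Dart) : LaurentRing K ↥G.edgeSet :=
  if dd.toProd.1 < dd.toProd.2 then LX ⟨dd.edge, dd.edge_mem⟩
  else - LX ⟨dd.edge, dd.edge_mem⟩

/-- The signed inverse Laurent variable `y_{st}⁻¹` attached to a dart of `G`. -/
def ydirEinv {n : ℕ} {G : SimpleGraph (Fin n)} (K : Type*) [CommRing K]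
    (dd : G.Dart) : LaurentRing K ↥G.edgeSet :=
  if dd.toProd.1 < dd.toProd.2 then LXinv ⟨dd.edge, dd.edge_mem⟩
  else - LXinv ⟨dd.edge, dd.edge_mem⟩

/-- The value of an edge function on a dart, with a sign recording its orientation. -/
def signedVal {n : ℕ} {G : SimpleGraph (Fin n)} {M : Type*} [Neg M]
    (y : G.edgeSet → M) (d : G.Dart) : M :=
  if d.toProd.1 < d.toProd.2 then y ⟨d.edge, d.edge_mem⟩ else - y ⟨d.edge, d.edge_mem⟩

theorem signedVal_symm {n : ℕ} {G : SimpleGraph (Fin n)} {M : Type*} [AddCommGroup M]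
    (y : G.edgeSet → M) (d : G.Dart) : signedVal y d.symm = - signedVal y d := by
  have he : (⟨d.symm.edge, d.symm.edge_mem⟩ : G.edgeSet) = ⟨d.edge, d.edge_mem⟩ :=
    Subtype.ext d.edge_symm
  have hne : d.toProd.1 ≠ d.toProd.2 := d.adj.ne
  unfold signedVal
  rw [he]
  simp only [SimpleGraph.Dart.symm_toProd, Prod.fst_swap, Prod.snd_swap]
  rcases lt_or_gt_of_ne hne with h | h
  · simp [h, h.not_gt]
  · simp [h, h.not_gt]

theorem map_signedVal {n : ℕ} {G : SimpleGraph (Fin n)} {M N F : Type*} [AddCommGroup M]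
    [AddCommGroup N] [FunLike F M N] [AddMonoidHomClass F M N] (f : F)
    (y : G.edgeSet → M) (d : G.Dart) : f (signedVal y d) = signedVal (fun e => f (y e)) d := by
  unfold signedVal
  split_ifs <;> simp

theorem signedVal_eq_of_adj {n : ℕ} {G : SimpleGraph (Fin n)} {M : Type*} [AddCommGroup M]
    {y : G.edgeSet → M} {h : Fin n → M} (H : ∀ d : G.Dart, d.fst < d.snd →
      y ⟨d.edge, d.edge_mem⟩ = h d.snd - h d.fst) (d : G.Dart) :
    signedVal y d = h d.snd - h d.fst := by
  rcases lt_or_gt_of_ne d.adj.ne with hd | hd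
  · rw [← H d hd]; simp [signedVal, hd]
  · have h1 := H d.symm hd
    have h2 := signedVal_symm y d
    have h3 : signedVal y d.symm = y ⟨d.symm.edge, d.symm.edge_mem⟩ := by
      unfold signedVal
      rw [if_pos]; exact hd
    rw [h3, h1] at h2
    rw [← neg_neg (signedVal y d), ← h2]
    simp

theorem sum_darts_potential {V : Type*} {G : SimpleGraph V} {M : Type*} [AddCommGroup M]
    {g : G.Dart → M} {h : V → M} (H : ∀ d : G.Dart, g d = h d.snd - h d.fst) {u v : V}
    (w : G.Walk u v) : (w.darts.map g).sum = h v - h u := by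
  induction w with
  | nil => simp
  | cons a p ih => simp [ih, H]

theorem sum_darts_bypass {V : Type*} [DecidableEq V] {G : SimpleGraph V} {M : Type*}
    [AddCommGroup M] {g : G.Dart → M} (hs : ∀ d, g d.symm = - g d)
    (hc : ∀ (v : V) (w : G.Walk v v), w.IsCycle → (w.darts.map g).sum = 0) {u v : V}
    (w : G.Walk u v) : (w.bypass.darts.map g).sum = (w.darts.map g).sum := by
  induction w with
  | nil => simp [SimpleGraph.Walk.bypass]
  | @cons a b c h p ih =>
    simp only [SimpleGraph.Walk.bypass]
    split_ifs with hmem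
    · have hsplit := congrArg (fun q => (q.darts.map g).sum) (p.bypass.take_spec hmem)
      simp only [SimpleGraph.Walk.darts_append, List.map_append, List.sum_append] at hsplit
      have htp : (p.bypass.takeUntil a hmem).IsPath := (p.bypass_isPath).takeUntil hmem
      generalize p.bypass.takeUntil a hmem = t at hsplit htp
      have key : g ⟨(a, b), h⟩ + (t.darts.map g).sum = 0 := by
        by_cases he : s(a, b) ∈ t.edges
        · cases t with
          | nil => exact absurd rfl h.ne
          | @cons _ x _ h' q =>
            have hb : x = a := by
              rw [SimpleGraph.Walk.cons_isPath_iff] at htp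
              rw [SimpleGraph.Walk.edges_cons, List.mem_cons] at he
              rcases he with he | he
              · rcases Sym2.eq_iff.mp he with h1 | h1
                · exact absurd h1.1 h.ne
                · exact h1.1.symm
              · exact absurd (q.snd_mem_support_of_mem_edges he) htp.2
            subst hb
            have : q = SimpleGraph.Walk.nil := by
              rw [SimpleGraph.Walk.cons_isPath_iff] at htp
              exact SimpleGraph.Walk.eq_nil_iff_nil.mpr (SimpleGraph.Walk.isPath_iff_nil.mp htp.1)
            subst this
            have := hs ⟨(x, b), h⟩
            have h2 : (⟨(x, b), h⟩ : G.Dart).symm = ⟨(b, x), h'⟩ := rfl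
            rw [h2] at this
            simp [this]
        · have := hc a _ ((SimpleGraph.Walk.cons_isCycle_iff t h).mpr ⟨htp, he⟩)
          simpa using this
      rw [SimpleGraph.Walk.darts_cons, List.map_cons, List.sum_cons, ← ih, ← hsplit, ← add_assoc,
        key, zero_add]
    · simp [ih]

/-- On a connected graph, an antisymmetric dart function whose sum along every cycle vanishes
is the coboundary of a potential. -/
theorem exists_potential {V : Type*} {G : SimpleGraph V} (hG : G.Connected)
    {M : Type*} [AddCommGroup M] {g : G.Dart → M} (hs : ∀ d, g d.symm = - g d)
    (hc : ∀ (v : V) (w : G.Walk v v), w.IsCycle → (w.darts.map g).sum = 0) (o : V) :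
    ∃ h : V → M, h o = 0 ∧ ∀ d : G.Dart, g d = h d.snd - h d.fst := by
  classical
  have closed : ∀ (v : V) (w : G.Walk v v), (w.darts.map g).sum = 0 := by
    intro v w
    rw [← sum_darts_bypass hs hc w, SimpleGraph.Walk.eq_nil_iff_nil.mpr
      (SimpleGraph.Walk.isPath_iff_nil.mp w.bypass_isPath)]
    simp
  have hr : ∀ {u v : V} (w : G.Walk u v),
      (w.reverse.darts.map g).sum = - (w.darts.map g).sum := by
    intro u v w
    have := closed u (w.append w.reverse)
    rw [SimpleGraph.Walk.darts_append, List.map_append, List.sum_append] at this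
    exact (neg_eq_of_add_eq_zero_right this).symm
  let W : ∀ v, G.Walk o v := fun v => (hG.preconnected o v).some
  refine ⟨fun v => ((W v).darts.map g).sum, closed o _, fun d => ?_⟩
  have := closed o (((W d.fst).append (SimpleGraph.Walk.cons d.adj SimpleGraph.Walk.nil)).append
    (W d.snd).reverse)
  simp only [SimpleGraph.Walk.darts_append, List.map_append, List.sum_append, hr] at this
  simp only [SimpleGraph.Walk.darts_cons, SimpleGraph.Walk.darts_nil, List.map_cons, List.map_nil,
    List.sum_cons, List.sum_nil, add_zero] at this
  have hd : (⟨(d.fst, d.snd), d.adj⟩ : G.Dart) = d := rfl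
  rw [hd] at this
  have h2 := eq_of_sub_eq_zero ((sub_eq_add_neg _ _).trans this)
  refine eq_sub_of_add_eq ?_
  rw [add_comm]
  exact h2

theorem exists_eval_ne_zero {σ k : Type*} [Field k] [Infinite k]
    {f : MvPolynomial σ k} (hf : f ≠ 0) : ∃ x : σ → k, MvPolynomial.eval x f ≠ 0 := by
  by_contra! h
  exact hf (MvPolynomial.funext fun x => by simpa using h x)

theorem exists_real_eval_ne_zero {σ : Type*} {g : MvPolynomial σ ℂ} (hg : g ≠ 0) :
    ∃ f : MvPolynomial σ ℝ, f ≠ 0 ∧ ∀ x : σ → ℝ, MvPolynomial.eval x f ≠ 0 →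
      MvPolynomial.eval (fun v => (x v : ℂ)) g ≠ 0 := by
  have key : ∀ g : MvPolynomial σ ℂ, ∃ r s : MvPolynomial σ ℝ,
      g = MvPolynomial.map (algebraMap ℝ ℂ) r +
        MvPolynomial.C Complex.I * MvPolynomial.map (algebraMap ℝ ℂ) s := by
    intro g
    induction g using MvPolynomial.induction_on with
    | C a =>
      refine ⟨MvPolynomial.C a.re, MvPolynomial.C a.im, ?_⟩
      simp only [MvPolynomial.map_C, ← MvPolynomial.C_mul, ← MvPolynomial.C_add]
      congr 1
      simp [mul_comm Complex.I]
    | add p q hp hq =>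
      obtain ⟨r, s, rfl⟩ := hp
      obtain ⟨r', s', rfl⟩ := hq
      exact ⟨r + r', s + s', by simp only [map_add]; ring⟩
    | mul_X p i hp =>
      obtain ⟨r, s, rfl⟩ := hp
      exact ⟨r * MvPolynomial.X i, s * MvPolynomial.X i, by
        simp only [map_mul, MvPolynomial.map_X]; ring⟩
  obtain ⟨r, s, hrs⟩ := key g
  have hev : ∀ x : σ → ℝ, MvPolynomial.eval (fun v => (x v : ℂ)) g =
      (MvPolynomial.eval x r : ℂ) + Complex.I * (MvPolynomial.eval x s : ℂ) := by
    have h1 : ∀ (x : σ → ℝ) (t : MvPolynomial σ ℝ), MvPolynomial.eval (fun v => (x v : ℂ))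
        (MvPolynomial.map (algebraMap ℝ ℂ) t) = (MvPolynomial.eval x t : ℂ) := by
      intro x t
      have := MvPolynomial.map_eval (algebraMap ℝ ℂ) x t
      exact this.symm
    intro x
    rw [hrs]
    simp only [map_add, map_mul, MvPolynomial.eval_C, h1]
  by_cases hr : r = 0
  · have hs : s ≠ 0 := by
      rintro rfl
      apply hg; rw [hrs, hr]; simp
    refine ⟨s, hs, fun x hx h0 => hx ?_⟩
    rw [hev] at h0
    have := congrArg Complex.im h0
    simpa using this
  · refine ⟨r, hr, fun x hx h0 => hx ?_⟩
    rw [hev] at h0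
    have := congrArg Complex.re h0
    simpa using this

/-- The squared-length polynomials whose values are the coordinates of the rigidity map. -/
def lengthPoly {n : ℕ} (G : SimpleGraph (Fin n)) (d : ℕ) (e : G.edgeSet) :
    MvPolynomial (Fin n × Fin d) ℂ :=
  Sym2.lift ⟨fun i j => MvPolynomial.C (2⁻¹ : ℂ) *
      ∑ k, (MvPolynomial.X (i, k) - MvPolynomial.X (j, k)) ^ 2,
    fun i j => by
      have h : ∀ k : Fin d, (MvPolynomial.X (i, k) - MvPolynomial.X (j, k) :
          MvPolynomial (Fin n × Fin d) ℂ) ^ 2 =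
          (MvPolynomial.X (j, k) - MvPolynomial.X (i, k)) ^ 2 := fun k => by ring
      simp only [h]⟩ (e : Sym2 (Fin n))

theorem eval_lengthPoly {n : ℕ} (G : SimpleGraph (Fin n)) (d : ℕ) (e : G.edgeSet)
    (p : Fin n → Fin d → ℂ) :
    MvPolynomial.eval (fun v => p v.1 v.2) (lengthPoly G d e) = rigidityMap G d p e := by
  obtain ⟨e, he⟩ := e
  induction e using Sym2.ind with
  | _ i j => simp [lengthPoly, rigidityMap]

theorem rigidityMap_ofReal {n : ℕ} (G : SimpleGraph (Fin n)) (d : ℕ)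
    (p : Fin n → Fin d → ℝ) {i j : Fin n} (h : s(i, j) ∈ G.edgeSet) :
    rigidityMap G d (fun i k => (p i k : ℂ)) ⟨s(i, j), h⟩ =
      ((2⁻¹ * ∑ k, (p i k - p j k) ^ 2 : ℝ) : ℂ) := by
  simp [rigidityMap]

theorem RealCongruent.sum_sq_eq {n d : ℕ} {p q : Fin n → Fin d → ℝ} (h : RealCongruent p q)
    (i j : Fin n) : ∑ k, (p i k - p j k) ^ 2 = ∑ k, (q i k - q j k) ^ 2 := by
  obtain ⟨A, x, -, hA, hp⟩ := h
  have e1 : ∀ v : Fin d → ℝ, ∑ k, v k ^ 2 = v ⬝ᵥ v := fun v => by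
    simp [dotProduct, sq]
  have e2 : p i - p j = A.mulVec (q i - q j) := by
    rw [hp i, hp j, Matrix.mulVec_sub]; abel
  have := e1 (p i - p j)
  rw [e2, Matrix.dotProduct_mulVec, Matrix.vecMul_mulVec, hA, Matrix.vecMul_one, ← e1, ← e2] at this
  simpa using this

theorem IsRigidGraph.connected {n d : ℕ} [NeZero n] [NeZero d] {G : SimpleGraph (Fin n)}
    (hG : IsRigidGraph G d) : G.Connected := by
  classical
  obtain ⟨f, hf, H⟩ := hG
  refine (SimpleGraph.connected_iff _).mpr ⟨?_, ⟨0⟩⟩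
  intro a b
  by_contra hab
  have hne : a ≠ b := by rintro rfl; exact hab (SimpleGraph.Reachable.refl _)
  have hg : (MvPolynomial.X (a, 0) - MvPolynomial.X (b, 0) :
      MvPolynomial (Fin n × Fin d) ℝ) ≠ 0 := by
    rw [sub_ne_zero]
    intro h
    exact hne (Prod.ext_iff.mp (MvPolynomial.X_injective h)).1
  obtain ⟨x, hx⟩ := exists_eval_ne_zero (mul_ne_zero hf hg)
  rw [map_mul] at hx
  let p : Fin n → Fin d → ℝ := fun i k => x (i, k)
  have hp := H p (left_ne_zero_of_mul hx)
  have hx2 : p a 0 ≠ p b 0 := by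
    have := right_ne_zero_of_mul hx
    simpa [sub_ne_zero] using this
  let q : ℝ → Fin n → Fin d → ℝ := fun t i k =>
    if G.Reachable a i then p i k + t * (p b k - p a k) else p i k
  have hq := hp q (Continuous.continuousOn (by
      refine continuous_pi fun i => continuous_pi fun k => ?_
      by_cases h : G.Reachable a i
      · simp only [q, h, if_true]; fun_prop
      · simp only [q, h, if_false]; fun_prop)) (by
      funext i k; simp [q]) (fun t _ i j hij => by
      have : G.Reachable a i ↔ G.Reachable a j :=
        ⟨fun h => h.trans hij.reachable, fun h => h.trans hij.symm.reachable⟩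
      refine Finset.sum_congr rfl fun k _ => ?_
      by_cases h : G.Reachable a i
      · simp [q, h, this.mp h]
      · have h' := mt this.mpr h
        simp [q, h, h']) 1 (by simp)
  have h1 := hq.sum_sq_eq a b
  have h2 : ∑ k, (q 1 a k - q 1 b k) ^ 2 = 0 :=
    Finset.sum_eq_zero fun k _ => by simp [q, hab]
  rw [h2] at h1
  have h3 := (Finset.sum_eq_zero_iff_of_nonneg (fun k _ => sq_nonneg (p a k - p b k))).mp h1.symm 0
    (Finset.mem_univ _)
  exact hx2 (sub_eq_zero.mp (by simpa using h3))

theorem IsRigidGraph.exists_adj_ne {n : ℕ} (hn : 3 ≤ n) {G : SimpleGraph (Fin n)}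
    (hG : IsRigidGraph G 2) {w x : Fin n} (hwx : w ≠ x) : ∃ y, G.Adj w y ∧ y ≠ x := by
  classical
  obtain ⟨f, hf, H⟩ := hG
  by_contra! hw
  obtain ⟨z, hzw, hzx⟩ : ∃ z : Fin n, z ≠ w ∧ z ≠ x := by
    by_contra! h
    have hsub : (Finset.univ : Finset (Fin n)) ⊆ {w, x} := fun z _ => by
      by_cases hz : z = w
      · simp [hz]
      · simp [h z hz]
    have := (Finset.card_le_card hsub).trans (Finset.card_le_two)
    simp at this
    omega
  let g : MvPolynomial (Fin n × Fin 2) ℝ :=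
    ∑ k, (MvPolynomial.X (x, k) - MvPolynomial.X (w, k)) *
      (MvPolynomial.X (x, k) - MvPolynomial.X (z, k))
  have hg : g ≠ 0 := by
    intro h0
    have := congrArg (MvPolynomial.eval
      (fun v : Fin n × Fin 2 => if v.1 = x then (0 : ℝ) else 1)) h0
    simp [g, hwx, hzx] at this
  obtain ⟨v, hv⟩ := exists_eval_ne_zero (mul_ne_zero hf hg)
  rw [map_mul] at hv
  let p : Fin n → Fin 2 → ℝ := fun i k => v (i, k)
  have hp := H p (left_ne_zero_of_mul hv)
  have hv2 : (p x 0 - p w 0) * (p x 0 - p z 0) + (p x 1 - p w 1) * (p x 1 - p z 1) ≠ 0 := by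
    have := right_ne_zero_of_mul hv
    simpa [g, Fin.sum_univ_two] using this
  let q : ℝ → Fin n → Fin 2 → ℝ := fun t i =>
    if i = w then
      ![p x 0 + (Real.cos (Real.pi * t) * (p w 0 - p x 0) -
          Real.sin (Real.pi * t) * (p w 1 - p x 1)),
        p x 1 + (Real.sin (Real.pi * t) * (p w 0 - p x 0) +
          Real.cos (Real.pi * t) * (p w 1 - p x 1))] else p i
  have hwq : ∀ t, ∑ k, (q t w k - q t x k) ^ 2 = ∑ k, (p w k - p x k) ^ 2 := by
    intro t
    simp only [q, hwx.symm, if_true, if_false, Fin.sum_univ_two, Matrix.cons_val_zero,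
      Matrix.cons_val_one]
    linear_combination ((p w 0 - p x 0) ^ 2 + (p w 1 - p x 1) ^ 2) *
      Real.sin_sq_add_cos_sq (Real.pi * t)
  have hq := hp q (Continuous.continuousOn (by
      refine continuous_pi fun i => continuous_pi fun k => ?_
      by_cases h : i = w
      · fin_cases k
        · simp only [q, h, if_true, Fin.zero_eta, Matrix.cons_val_zero]; fun_prop
        · simp only [q, h, if_true, Fin.mk_one, Matrix.cons_val_one]; fun_prop
      · simp only [q, h, if_false]; fun_prop)) (by
      funext i k
      by_cases h : i = w
      · fin_cases k <;> simp [q, h]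
      · simp [q, h]) (fun t _ i j hij => by
      by_cases hi : i = w
      · subst hi
        rw [hw j hij, hwq]
      · by_cases hj : j = w
        · subst hj
          have := hwq t
          rw [hw i hij.symm]
          simp only [sub_sq_comm _ (q t j _), sub_sq_comm _ (p j _)]
          exact hwq t
        · simp [q, hi, hj]) 1 (by simp)
  have h1 := hq.sum_sq_eq w z
  simp only [q, hzw, if_true, if_false, Fin.sum_univ_two, Matrix.cons_val_zero,
      Matrix.cons_val_one, mul_one, Real.cos_pi, Real.sin_pi] at h1
  apply hv2
  linear_combination h1 / 4

theorem IsRigidGraph.card_le_card_edges {n : ℕ} (hn : 3 ≤ n) {G : SimpleGraph (Fin n)}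
    (hG : IsRigidGraph G 2) : n ≤ Nat.card G.edgeSet := by
  classical
  have hdeg : ∀ w, 2 ≤ G.degree w := by
    intro w
    have hx : ∃ x : Fin n, w ≠ x := by
      have : Nontrivial (Fin n) := Fin.nontrivial_iff_two_le.mpr (by omega)
      exact (exists_ne w).imp fun _ h => h.symm
    obtain ⟨x, hx⟩ := hx
    obtain ⟨y, hy, -⟩ := hG.exists_adj_ne hn hx
    obtain ⟨z, hz, hzy⟩ := hG.exists_adj_ne hn hy.ne
    rw [← G.card_neighborFinset_eq_degree]
    refine Finset.one_lt_card.mpr ⟨y, by simpa using hy, z, by simpa using hz, hzy.symm⟩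
  have h1 := G.sum_degrees_eq_twice_card_edges
  have h2 : ∑ _v : Fin n, 2 ≤ ∑ v, G.degree v := Finset.sum_le_sum fun v _ => hdeg v
  simp at h2
  rw [Nat.card_eq_fintype_card, ← SimpleGraph.edgeFinset_card]
  omega

/-- The squared-length polynomials of a minimally rigid graph are algebraically independent. -/
theorem IsMinimallyRigidGraph.algebraicIndependent {n d : ℕ} {G : SimpleGraph (Fin n)}
    (hG : IsMinimallyRigidGraph G d) : AlgebraicIndependent ℂ (lengthPoly G d) := by
  refine algebraicIndependent_of_finite_type' (MvPolynomial.C_injective _ _) ?_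
  rintro s - - e hes ⟨P, hP0, hP⟩
  apply hG.2 e e.2
  obtain ⟨f, hf, H⟩ := hG.1
  have hlead : (P.leadingCoeff : MvPolynomial (Fin n × Fin d) ℂ) ≠ 0 := by
    simpa using hP0
  obtain ⟨g, hg, hgl⟩ := exists_real_eval_ne_zero hlead
  refine ⟨f * g, mul_ne_zero hf hg, fun p hp => ?_⟩
  rw [map_mul] at hp
  intro q hqc hq0 hq
  refine H p (left_ne_zero_of_mul hp) q hqc hq0 ?_
  let ev : ℝ → MvPolynomial (Fin n × Fin d) ℂ →ₐ[ℂ] ℂ := fun t =>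
    MvPolynomial.aeval (fun v => (q t v.1 v.2 : ℂ))
  have hev : ∀ t (i j : Fin n) (h : s(i, j) ∈ G.edgeSet), ev t (lengthPoly G d ⟨s(i, j), h⟩) =
      ((2⁻¹ * ∑ k, (q t i k - q t j k) ^ 2 : ℝ) : ℂ) := by
    intro t i j h
    rw [← rigidityMap_ofReal G d (q t) h, ← eval_lengthPoly]
    rfl
  have hagree : ∀ t ∈ Set.Icc (0 : ℝ) 1, Set.EqOn (ev t) (ev 0)
      (Algebra.adjoin ℂ (lengthPoly G d '' s)) := by
    intro t ht
    refine AlgHom.eqOn_adjoin_iff.mpr ?_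
    rintro _ ⟨⟨e', he'⟩, hs', rfl⟩
    induction e' using Sym2.ind with
    | _ i j =>
      rw [hev, hev, hq0, hq t ht i j]
      rw [SimpleGraph.deleteEdges_adj]
      refine ⟨he', fun h => hes ?_⟩
      have : e = ⟨s(i, j), he'⟩ := Subtype.ext (Set.mem_singleton_iff.mp h).symm
      rwa [this]
  let A := Algebra.adjoin ℂ (lengthPoly G d '' s)
  let P0 : Polynomial ℂ := P.map ((ev 0).toRingHom.comp (algebraMap A (MvPolynomial _ ℂ)))
  have hP00 : P0 ≠ 0 := by
    intro h0
    have h1 := congrArg (fun r => Polynomial.coeff r P.natDegree) h0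
    simp only [P0, Polynomial.coeff_map, Polynomial.coeff_zero] at h1
    refine hgl _ (right_ne_zero_of_mul hp) ?_
    rw [← hq0]
    exact h1
  have hroot : ∀ t ∈ Set.Icc (0 : ℝ) 1, ev t (lengthPoly G d e) ∈ P0.rootSet ℂ := by
    intro t ht
    rw [Polynomial.mem_rootSet]
    refine ⟨hP00, ?_⟩
    have hm : P0 = P.map ((ev t).toRingHom.comp (algebraMap A (MvPolynomial _ ℂ))) := by
      refine Polynomial.ext fun k => ?_
      simp only [P0, Polynomial.coeff_map]
      exact (hagree t ht (P.coeff k).2).symm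
    have h2 := congrArg (ev t).toRingHom hP
    rw [Polynomial.aeval_def, Polynomial.hom_eval₂, map_zero] at h2
    rw [hm, Polynomial.aeval_def, Polynomial.eval₂_map]
    exact h2
  have hcont : ContinuousOn (fun t => ev t (lengthPoly G d e)) (Set.Icc 0 1) := by
    obtain ⟨e, he⟩ := e
    induction e using Sym2.ind with
    | _ i j =>
      simp only [hev]
      have hqk : ∀ (i : Fin n) (k : Fin d), ContinuousOn (fun t => q t i k) (Set.Icc 0 1) :=
        fun i k => continuousOn_pi.mp (continuousOn_pi.mp hqc i) k
      refine Complex.continuous_ofReal.comp_continuousOn (continuousOn_const.mul ?_)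
      exact continuousOn_finsetSum _ fun k _ => ((hqk i k).sub (hqk j k)).pow 2
  have hconst : ∀ t ∈ Set.Icc (0 : ℝ) 1, ev t (lengthPoly G d e) = ev 0 (lengthPoly G d e) := by
    intro t ht
    have hfin : (P0.rootSet ℂ).Finite := P0.rootSet_finite ℂ
    have himg := (isPreconnected_Icc (a := (0 : ℝ)) (b := 1)).image _ hcont
    have hsub : (fun t => ev t (lengthPoly G d e)) '' Set.Icc (0 : ℝ) 1 ⊆ P0.rootSet ℂ := by
      rintro _ ⟨t, ht, rfl⟩; exact hroot t ht
    exact (Set.Finite.countable hfin).isTotallyDisconnected _ hsub himg ⟨t, ht, rfl⟩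
      ⟨0, by simp, rfl⟩
  intro t ht i j hij
  by_cases hije : s(i, j) = (e : Sym2 (Fin n))
  · have he' : e = ⟨s(i, j), G.mem_edgeSet.mpr hij⟩ := Subtype.ext hije.symm
    have h3 := hconst t ht
    rw [he', hev, hev, hq0] at h3
    have h4 := Complex.ofReal_injective h3
    linarith
  · exact hq t ht i j (by rw [SimpleGraph.deleteEdges_adj]; exact ⟨hij, by simpa using hije⟩)

/-- The difference of a vertex function along an edge, oriented increasingly. -/
def edgeDiff {n : ℕ} {G : SimpleGraph (Fin n)} {M : Type*} [Sub M] (h : Fin n → M)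
    (e : G.edgeSet) : M :=
  h (e : Sym2 (Fin n)).sup - h (e : Sym2 (Fin n)).inf

theorem signedVal_edgeDiff {n : ℕ} {G : SimpleGraph (Fin n)} {M : Type*} [AddCommGroup M]
    (h : Fin n → M) (d : G.Dart) : signedVal (edgeDiff h) d = h d.snd - h d.fst := by
  refine signedVal_eq_of_adj (fun d hd => ?_) d
  change h (max d.fst d.snd) - h (min d.fst d.snd) = _
  rw [max_eq_right hd.le, min_eq_left hd.le]

theorem exists_dart_lt {n : ℕ} {G : SimpleGraph (Fin n)} (e : G.edgeSet) :
    ∃ d : G.Dart, d.fst < d.snd ∧ (⟨d.edge, d.edge_mem⟩ : G.edgeSet) = e := by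
  obtain ⟨e, he⟩ := e
  induction e using Sym2.ind with
  | _ i j =>
    have hij : G.Adj i j := he
    rcases lt_or_gt_of_ne hij.ne with h | h
    · exact ⟨⟨(i, j), hij⟩, h, rfl⟩
    · exact ⟨⟨(j, i), hij.symm⟩, h, Subtype.ext Sym2.eq_swap⟩

theorem eq_edgeDiff_of_signedVal {n : ℕ} {G : SimpleGraph (Fin n)} {M : Type*} [AddCommGroup M]
    {y : G.edgeSet → M} {h : Fin n → M} (H : ∀ d : G.Dart, signedVal y d = h d.snd - h d.fst) :
    y = edgeDiff h := by
  funext e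
  obtain ⟨d, hd, rfl⟩ := exists_dart_lt e
  have h1 := (H d).trans (signedVal_edgeDiff h d).symm
  simp only [signedVal] at h1
  rwa [if_pos hd, if_pos hd] at h1

theorem sub_eq_sub_of_edgeDiff_eq {n : ℕ} {G : SimpleGraph (Fin n)} (hG : G.Connected)
    {M : Type*} [AddCommGroup M] {g h : Fin n → M}
    (H : ∀ e : G.edgeSet, edgeDiff g e = edgeDiff h e) (i j : Fin n) : g i - g j = h i - h j := by
  have key : ∀ d : G.Dart, g d.snd - g d.fst = h d.snd - h d.fst := fun d => by
    rw [← signedVal_edgeDiff, ← signedVal_edgeDiff, funext H]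
  obtain ⟨w⟩ := hG.preconnected j i
  rw [← sum_darts_potential (fun d => (rfl : g d.snd - g d.fst = _)) w,
    ← sum_darts_potential key w]

/-- The torus points of the cycle system with parameters `a`, `c`. -/
def cycleSolutions {n : ℕ} [NeZero n] (G : SimpleGraph (Fin n)) (h12 : G.Adj 0 1) {k : Type*}
    [Field k] (a : G.edgeSet → k) (c : Fin 2 → k) : Set (G.edgeSet → k) :=
  {y | (∀ e, y e ≠ 0) ∧
    (∀ (v : Fin n) (w : G.Walk v v), w.IsCycle → (w.darts.map fun d => signedVal y d).sum = 0) ∧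
    (∀ (v : Fin n) (w : G.Walk v v), w.IsCycle → (w.darts.map fun d =>
      a ⟨d.edge, d.edge_mem⟩ * signedVal (fun e => (y e)⁻¹) d).sum = 0) ∧
    c 0 * y ⟨s(0, 1), G.mem_edgeSet.mpr h12⟩ ^ 2 + c 1 = 0}

theorem mul_signedVal {n : ℕ} {G : SimpleGraph (Fin n)} {R : Type*} [Ring R]
    (a y : G.edgeSet → R) (d : G.Dart) :
    a ⟨d.edge, d.edge_mem⟩ * signedVal y d = signedVal (fun e => a e * y e) d := by
  unfold signedVal
  split_ifs <;> simp

theorem mem_cycleSolutions_iff {n : ℕ} [NeZero n] {G : SimpleGraph (Fin n)} (hG : G.Connected)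
    (h12 : G.Adj 0 1) {k : Type*} [Field k] {a : G.edgeSet → k} {c : Fin 2 → k}
    (ha : ∀ e, a e ≠ 0) {y : G.edgeSet → k} :
    y ∈ cycleSolutions G h12 a c ↔ ∃ u v : Fin n → k, y = edgeDiff u ∧
      (∀ e : G.edgeSet, edgeDiff u e * edgeDiff v e = a e) ∧
      c 0 * y ⟨s(0, 1), G.mem_edgeSet.mpr h12⟩ ^ 2 + c 1 = 0 := by
  constructor
  · rintro ⟨h0, h1, h2, h3⟩
    simp only [mul_signedVal a] at h2
    obtain ⟨u, -, hu⟩ := exists_potential hG (signedVal_symm y) h1 0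
    obtain ⟨v, -, hv⟩ := exists_potential hG (signedVal_symm _) h2 0
    have hu' := eq_edgeDiff_of_signedVal hu
    refine ⟨u, v, hu', fun e => ?_, h3⟩
    rw [← hu', ← congrFun (eq_edgeDiff_of_signedVal hv) e]
    field_simp [h0 e]
  · rintro ⟨u, v, rfl, huv, h3⟩
    have hne : ∀ e : G.edgeSet, edgeDiff u e ≠ 0 := fun e h => ha e (by rw [← huv, h, zero_mul])
    refine ⟨hne, fun x w _ => ?_, fun x w _ => ?_, h3⟩
    · rw [sum_darts_potential (fun d => signedVal_edgeDiff u d), sub_self]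
    · have : (fun e : G.edgeSet => a e * (edgeDiff u e)⁻¹) = edgeDiff v := by
        funext e
        rw [← huv e]; field_simp [hne e]
      simp only [mul_signedVal a, this]
      rw [sum_darts_potential (fun d => signedVal_edgeDiff v d), sub_self]

/-- The two isotropic coordinates of a planar complex realisation. -/
def isoCoord {n : ℕ} (b : Bool) (q : Fin n → Fin 2 → ℂ) (i : Fin n) : ℂ :=
  q i 0 + (if b then Complex.I else -Complex.I) * q i 1

theorem rigidityMap_eq_isoCoord {n : ℕ} {G : SimpleGraph (Fin n)} (b : Bool)
    (q : Fin n → Fin 2 → ℂ) (e : G.edgeSet) : rigidityMap G 2 q e =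
      2⁻¹ * (edgeDiff (isoCoord b q) e * edgeDiff (isoCoord (!b) q) e) := by
  obtain ⟨d, hd, rfl⟩ := exists_dart_lt e
  change 2⁻¹ * ∑ k, (q d.fst k - q d.snd k) ^ 2 = 2⁻¹ * ((isoCoord b q (max d.fst d.snd) -
    isoCoord b q (min d.fst d.snd)) * (isoCoord (!b) q (max d.fst d.snd) -
    isoCoord (!b) q (min d.fst d.snd)))
  rw [max_eq_right hd.le, min_eq_left hd.le, Fin.sum_univ_two]
  cases b <;> simp [isoCoord] <;>
    linear_combination (q d.fst 1 - q d.snd 1) ^ 2 * Complex.I_sq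

theorem Congruent.refl {n d : ℕ} (p : Fin n → Fin d → ℂ) : Congruent p p :=
  ⟨1, 0, by simp, by simp, fun i => by simp⟩

theorem Congruent.symm {n d : ℕ} {p q : Fin n → Fin d → ℂ} (h : Congruent p q) :
    Congruent q p := by
  obtain ⟨A, x, h1, h2, h⟩ := h
  refine ⟨A.transpose, - A.transpose.mulVec x, by simpa using h2, by simpa using h1, fun i => ?_⟩
  rw [h i, Matrix.mulVec_add, Matrix.mulVec_mulVec, h2]
  simp

theorem Congruent.trans {n d : ℕ} {p q r : Fin n → Fin d → ℂ} (h : Congruent p q)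
    (h' : Congruent q r) : Congruent p r := by
  obtain ⟨A, x, h1, h2, h⟩ := h
  obtain ⟨B, y, h1', h2', h'⟩ := h'
  refine ⟨A * B, A.mulVec y + x, ?_, ?_, fun i => ?_⟩
  · rw [Matrix.transpose_mul, Matrix.mul_assoc, ← Matrix.mul_assoc B, h1', Matrix.one_mul, h1]
  · rw [Matrix.transpose_mul, Matrix.mul_assoc, ← Matrix.mul_assoc _ A, h2, Matrix.one_mul, h2']
  · rw [h i, h' i, Matrix.mulVec_add, Matrix.mulVec_mulVec, add_assoc]

theorem Congruent.exists_isoCoord {n : ℕ} {p q : Fin n → Fin 2 → ℂ} (h : Congruent p q) :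
    ∃ (b : Bool) (s : ℂ), s ≠ 0 ∧ ∀ i j,
      isoCoord b p i - isoCoord b p j = s * (isoCoord true q i - isoCoord true q j) := by
  obtain ⟨A, x, h1, h2, h⟩ := h
  have e1 := congrFun (congrFun h1 0) 0
  have e2 := congrFun (congrFun h1 0) 1
  have e4 := congrFun (congrFun h2 0) 0
  have e5 := congrFun (congrFun h2 0) 1
  have e6 := congrFun (congrFun h2 1) 1
  simp [Matrix.mul_apply, Fin.sum_univ_two] at e1 e2 e4 e5 e6
  have hp : ∀ i k, p i k = A k 0 * q i 0 + A k 1 * q i 1 + x k := fun i k => by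
    rw [h i]; fin_cases k <;> simp
  have hdet : (A 0 0 * A 1 1 - A 0 1 * A 1 0 - 1) * (A 0 0 * A 1 1 - A 0 1 * A 1 0 + 1) = 0 := by
    linear_combination (A 0 1 * A 0 1 + A 1 1 * A 1 1) * e4 + e6 -
      (A 0 0 * A 0 1 + A 1 0 * A 1 1) * e5
  rcases mul_eq_zero.mp hdet with hd | hd
  · have hd1 : A 1 1 = A 0 0 := by
      linear_combination A 0 0 * hd - A 1 1 * e4 + A 1 0 * e5
    have hb : A 0 1 = - A 1 0 := by
      linear_combination -A 1 0 * hd - A 0 1 * e4 + A 0 0 * e5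
    refine ⟨true, A 0 0 + Complex.I * A 1 0, fun h0 => ?_, fun i j => ?_⟩
    · have : (A 0 0 + Complex.I * A 1 0) * (A 0 0 - Complex.I * A 1 0) = 1 := by
        linear_combination e4 - A 1 0 ^ 2 * Complex.I_sq
      rw [h0, zero_mul] at this
      exact zero_ne_one this
    · simp only [isoCoord, if_true, hp, hd1, hb]
      linear_combination (- A 1 0 * (q i 1 - q j 1)) * Complex.I_sq
  · have hd1 : A 1 1 = - A 0 0 := by
      linear_combination A 0 0 * hd - A 1 1 * e4 + A 1 0 * e5
    have hb : A 0 1 = A 1 0 := by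
      linear_combination -A 1 0 * hd - A 0 1 * e4 + A 0 0 * e5
    refine ⟨false, A 0 0 - Complex.I * A 1 0, fun h0 => ?_, fun i j => ?_⟩
    · have : (A 0 0 + Complex.I * A 1 0) * (A 0 0 - Complex.I * A 1 0) = 1 := by
        linear_combination e4 - A 1 0 ^ 2 * Complex.I_sq
      rw [h0, mul_zero] at this
      exact zero_ne_one this
    · simp only [isoCoord, if_true, hp, hd1, hb]
      simp
      linear_combination (A 1 0 * (q i 1 - q j 1)) * Complex.I_sq

theorem congruent_of_isoCoord_true {n : ℕ} [NeZero n] {p q : Fin n → Fin 2 → ℂ} {b : Bool} {s : ℂ}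
    (hs : s ≠ 0)
    (h1 : ∀ i j, isoCoord true p i - isoCoord true p j = s * (isoCoord b q i - isoCoord b q j))
    (h2 : ∀ i j, isoCoord false p i - isoCoord false p j =
      s⁻¹ * (isoCoord (!b) q i - isoCoord (!b) q j)) : Congruent p q := by
  set α : ℂ := (s + s⁻¹) / 2 with hα
  set β : ℂ := (s - s⁻¹) / 2 * (-Complex.I) with hβ
  set ε : ℂ := if b then 1 else -1 with hε
  have hε2 : ε * ε = 1 := by rw [hε]; split_ifs <;> norm_num
  have hαβ : α * α + β * β = 1 := by
    have : s * s⁻¹ = 1 := mul_inv_cancel₀ hs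
    rw [hα, hβ]
    linear_combination this + ((s - s⁻¹) / 2) ^ 2 * Complex.I_sq
  let A : Matrix (Fin 2) (Fin 2) ℂ := !![α, -(ε * β); β, ε * α]
  refine ⟨A, p 0 - A.mulVec (q 0), ?_, ?_, fun i => ?_⟩
  · ext i j
    fin_cases i <;> fin_cases j <;> simp [A, Matrix.mul_apply, Fin.sum_univ_two]
    · linear_combination hαβ + β * β * hε2
    · linear_combination -α * β * hε2
    · linear_combination -α * β * hε2
    · linear_combination hαβ + α * α * hε2
  · ext i j
    fin_cases i <;> fin_cases j <;> simp [A, Matrix.mul_apply, Fin.sum_univ_two]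
    · linear_combination hαβ
    · ring
    · ring
    · linear_combination ε * ε * hαβ + hε2
  · have e1 := h1 i 0
    have e2 := h2 i 0
    have hsI : Complex.I * β = (s - s⁻¹) / 2 := by
      rw [hβ]; linear_combination -((s - s⁻¹) / 2) * Complex.I_sq
    have hs1 : s = α + Complex.I * β := by rw [hsI, hα]; ring
    have hs2 : s⁻¹ = α - Complex.I * β := by rw [hsI, hα]; ring
    rw [hs1] at e1
    rw [hs2] at e2
    have hI := Complex.I_sq
    ext k
    clear_value α β ε
    cases b <;> simp [isoCoord] at e1 e2 hε <;> subst hε <;> fin_cases k <;>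
      simp [A, Matrix.vecHead, Matrix.vecTail]
    · linear_combination 2⁻¹ * e1 + 2⁻¹ * e2 + (-β * (q i 1 - q 0 1)) * hI
    · linear_combination -Complex.I / 2 * e1 + Complex.I / 2 * e2 +
        (p i 1 - p 0 1 + α * (q i 1 - q 0 1) - β * (q i 0 - q 0 0)) * hI
    · linear_combination 2⁻¹ * e1 + 2⁻¹ * e2 + (β * (q i 1 - q 0 1)) * hI
    · linear_combination -Complex.I / 2 * e1 + Complex.I / 2 * e2 +
        (p i 1 - p 0 1 - α * (q i 1 - q 0 1) - β * (q i 0 - q 0 0)) * hI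

theorem congruent_of_isoCoord {n : ℕ} [NeZero n] {p q : Fin n → Fin 2 → ℂ} {b b' : Bool} {s : ℂ}
    (hs : s ≠ 0)
    (h1 : ∀ i j, isoCoord b p i - isoCoord b p j = s * (isoCoord b' q i - isoCoord b' q j))
    (h2 : ∀ i j, isoCoord (!b) p i - isoCoord (!b) p j =
      s⁻¹ * (isoCoord (!b') q i - isoCoord (!b') q j)) : Congruent p q := by
  cases b
  · exact congruent_of_isoCoord_true (inv_ne_zero hs) h2 (by simpa using h1)
  · exact congruent_of_isoCoord_true hs h1 h2

theorem isoCoord_sub_of_edges {n : ℕ} {G : SimpleGraph (Fin n)} (hG : G.Connected)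
    {g h : Fin n → ℂ} {s : ℂ} (H : ∀ e : G.edgeSet, edgeDiff g e = s * edgeDiff h e)
    (i j : Fin n) : g i - g j = s * (h i - h j) := by
  rw [mul_sub]
  exact sub_eq_sub_of_edgeDiff_eq hG (h := fun i => s * h i)
    (fun e => (H e).trans (mul_sub _ _ _)) i j

theorem edgeDiff_of_sub {n : ℕ} {G : SimpleGraph (Fin n)} {g h : Fin n → ℂ} {s : ℂ}
    (H : ∀ i j, g i - g j = s * (h i - h j)) (e : G.edgeSet) :
    edgeDiff g e = s * edgeDiff h e := H _ _

theorem congClass_eq_iff {n d : ℕ} {S : Set (Fin n → Fin d → ℂ)} {q r : Fin n → Fin d → ℂ}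
    (hr : r ∈ S) :
    {q' ∈ S | Congruent q q'} = {q' ∈ S | Congruent r q'} ↔ Congruent q r := by
  constructor
  · intro h
    have : r ∈ {q' ∈ S | Congruent r q'} := ⟨hr, Congruent.refl r⟩
    rw [← h] at this
    exact this.2
  · intro h
    ext x
    exact and_congr_right fun _ => ⟨fun hx => h.symm.trans hx, fun hx => h.trans hx⟩

/-- Each congruence class of realisations with given edge lengths, none of which is collinear
along an isotropic direction, contributes exactly four solutions of the cycle system. -/
theorem card_cycleSolutions {n : ℕ} [NeZero n] {G : SimpleGraph (Fin n)} (hG : G.Connected)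
    (h12 : G.Adj 0 1) {a : G.edgeSet → ℂ} {c : Fin 2 → ℂ} (ha : ∀ e, a e ≠ 0)
    (hc0 : c 0 ≠ 0) (hc1 : c 1 ≠ 0)
    (hcol : ∀ h : Fin n → ℂ, ∃ e : G.edgeSet, a e ≠ edgeDiff h e ^ 2) :
    Nat.card (cycleSolutions G h12 a c) =
      4 * (congClasses {q | rigidityMap G 2 q = a}).ncard := by
  set S : Set (Fin n → Fin 2 → ℂ) := {q | rigidityMap G 2 q = a} with hS
  let e01 : G.edgeSet := ⟨s(0, 1), G.mem_edgeSet.mpr h12⟩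
  obtain ⟨ζ, hζ⟩ := IsAlgClosed.exists_pow_nat_eq (-c 1 / c 0) (n := 2) two_pos
  have hζ0 : ζ ≠ 0 := by
    rintro rfl
    rw [zero_pow two_ne_zero, eq_comm, div_eq_zero_iff, neg_eq_zero] at hζ
    exact hζ.elim hc1 hc0
  have hex : ∀ κ : congClasses S, ∃ q ∈ S, {q' ∈ S | Congruent q q'} = κ := fun κ => κ.2
  choose rep hrepS hrep using hex
  have hprod : ∀ q ∈ S, ∀ b (e : G.edgeSet),
      edgeDiff (isoCoord b q) e * edgeDiff (isoCoord (!b) q) e = 2 * a e := by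
    intro q hq b e
    have h1 := rigidityMap_eq_isoCoord b q e
    rw [show rigidityMap G 2 q = a from hq] at h1
    rw [h1]; ring
  have hne : ∀ q ∈ S, ∀ b (e : G.edgeSet), edgeDiff (isoCoord b q) e ≠ 0 := by
    intro q hq b e h0
    have := hprod q hq b e
    rw [h0, zero_mul] at this
    exact ha e (by simpa using this.symm)
  let sg : Bool → ℂ := fun ε => if ε then ζ else -ζ
  have hsg0 : ∀ ε, sg ε ≠ 0 := fun ε => by
    cases ε <;> simp [sg, hζ0]
  have hsg2 : ∀ ε, sg ε ^ 2 = -c 1 / c 0 := fun ε => by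
    cases ε <;> simp [sg, hζ]
  have hsginj : ∀ ε ε', sg ε = sg ε' → ε = ε' := by
    intro ε ε' h
    have : ζ ≠ -ζ := fun h => hζ0 (self_eq_neg.mp h)
    cases ε <;> cases ε' <;> simp_all [sg]
  let coef : congClasses S → Bool → Bool → ℂ := fun κ b ε =>
    sg ε / edgeDiff (isoCoord b (rep κ)) e01
  have hcoef : ∀ κ b ε, coef κ b ε ≠ 0 := fun κ b ε =>
    div_ne_zero (hsg0 ε) (hne _ (hrepS κ) b e01)
  have hcoef1 : ∀ κ b ε, coef κ b ε * edgeDiff (isoCoord b (rep κ)) e01 = sg ε := fun κ b ε =>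
    div_mul_cancel₀ _ (hne _ (hrepS κ) b e01)
  let Ψ : congClasses S × Bool × Bool → cycleSolutions G h12 a c := fun x =>
    ⟨fun e => coef x.1 x.2.1 x.2.2 * edgeDiff (isoCoord x.2.1 (rep x.1)) e, by
      obtain ⟨κ, b, ε⟩ := x
      refine (mem_cycleSolutions_iff hG h12 ha).mpr
        ⟨fun i => coef κ b ε * isoCoord b (rep κ) i,
        fun i => (2 * coef κ b ε)⁻¹ * isoCoord (!b) (rep κ) i, ?_, fun e => ?_, ?_⟩
      · funext e; exact mul_sub _ _ _
      · have h1 := hprod _ (hrepS κ) b e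
        have h2 : coef κ b ε * (2 * coef κ b ε)⁻¹ = 2⁻¹ := by
          have := hcoef κ b ε
          field_simp
        simp only [edgeDiff] at h1 ⊢
        rw [← mul_sub, ← mul_sub, mul_mul_mul_comm, h1, h2]
        ring
      · simp only
        have h1 := hcoef1 κ b ε
        have h2 := hsg2 ε
        rw [← h1, eq_div_iff hc0] at h2
        linear_combination h2⟩
  have hΨ : Function.Bijective Ψ := by
    constructor
    · rintro ⟨κ, b, ε⟩ ⟨κ', b', ε'⟩ h
      have h1 : ∀ e : G.edgeSet, coef κ b ε * edgeDiff (isoCoord b (rep κ)) e =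
          coef κ' b' ε' * edgeDiff (isoCoord b' (rep κ')) e := fun e =>
        congrFun (congrArg Subtype.val h) e
      have hε : ε = ε' := by
        have := h1 e01
        rw [hcoef1, hcoef1] at this
        exact hsginj _ _ this
      subst hε
      have hk := hcoef κ b ε
      have hk' := hcoef κ' b' ε
      set s := (coef κ b ε)⁻¹ * coef κ' b' ε with hs
      have hs0 : s ≠ 0 := mul_ne_zero (inv_ne_zero hk) hk'
      have h2 : ∀ e : G.edgeSet, edgeDiff (isoCoord b (rep κ)) e =
          s * edgeDiff (isoCoord b' (rep κ')) e := fun e => by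
        rw [hs, mul_assoc, ← h1 e, inv_mul_cancel_left₀ hk]
      have h3 : ∀ e : G.edgeSet, edgeDiff (isoCoord (!b) (rep κ)) e =
          s⁻¹ * edgeDiff (isoCoord (!b') (rep κ')) e := fun e => by
        have p1 := hprod _ (hrepS κ) b e
        rw [← hprod _ (hrepS κ') b' e, h2 e] at p1
        have hn := hne _ (hrepS κ') b' e
        refine mul_left_cancel₀ (mul_ne_zero hs0 hn) ?_
        rw [p1]; field_simp
      have hcong : Congruent (rep κ) (rep κ') :=
        congruent_of_isoCoord hs0 (isoCoord_sub_of_edges hG h2) (isoCoord_sub_of_edges hG h3)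
      have hκ : κ = κ' := by
        apply Subtype.ext
        rw [← hrep κ, ← hrep κ']
        exact (congClass_eq_iff (hrepS κ')).mpr hcong
      subst hκ
      by_cases hb : b = b'
      · rw [hb]
      · exfalso
        have hb' : b = !b' := by cases b <;> cases b' <;> simp_all
        subst hb'
        obtain ⟨t, ht⟩ := IsAlgClosed.exists_pow_nat_eq (s / 2) (n := 2) two_pos
        obtain ⟨e, he⟩ := hcol fun i => t * isoCoord b' (rep κ) i
        apply he
        have p1 := hprod _ (hrepS κ) b' e
        rw [h2 e] at p1
        have : edgeDiff (fun i => t * isoCoord b' (rep κ) i) e =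
          t * edgeDiff (isoCoord b' (rep κ)) e := (mul_sub _ _ _).symm
        rw [this, mul_pow, ht]
        linear_combination -(1 / 2) * p1
    · rintro ⟨y, hy⟩
      obtain ⟨u, v, rfl, huv, hcy⟩ := (mem_cycleSolutions_iff hG h12 ha).mp hy
      let q : Fin n → Fin 2 → ℂ := fun i =>
        ![(u i + 2 * v i) / 2, (u i - 2 * v i) / 2 * (-Complex.I)]
      have hqu : isoCoord true q = u := by
        funext i
        simp only [isoCoord, q, if_true, Matrix.cons_val_zero, Matrix.cons_val_one]
        linear_combination (-(u i - 2 * v i) / 2) * Complex.I_sq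
      have hqv : isoCoord false q = fun i => 2 * v i := by
        funext i
        simp [isoCoord, q]
        linear_combination ((u i - 2 * v i) / 2) * Complex.I_sq
      have hqS : q ∈ S := by
        change rigidityMap G 2 q = a
        funext e
        rw [rigidityMap_eq_isoCoord true, Bool.not_true, hqu, hqv, ← huv e]
        simp only [edgeDiff]
        ring
      let κ : congClasses S := ⟨_, q, hqS, rfl⟩
      have hcong : Congruent (rep κ) q := (congClass_eq_iff hqS).mp (hrep κ)
      obtain ⟨b, s, hs, H⟩ := hcong.exists_isoCoord
      rw [hqu] at H
      have H' : ∀ e : G.edgeSet, edgeDiff (isoCoord b (rep κ)) e = s * edgeDiff u e :=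
        edgeDiff_of_sub H
      have hu0 : edgeDiff u e01 ≠ 0 := hy.1 e01
      obtain ⟨ε, hε⟩ : ∃ ε, edgeDiff u e01 = sg ε := by
        have h2 : edgeDiff u e01 ^ 2 = ζ ^ 2 := by
          rw [hζ, eq_div_iff hc0]
          linear_combination hcy
        rcases sq_eq_sq_iff_eq_or_eq_neg.mp h2 with h | h
        · exact ⟨true, by simpa [sg] using h⟩
        · exact ⟨false, by simpa [sg] using h⟩
      refine ⟨⟨κ, b, ε⟩, Subtype.ext ?_⟩
      funext e
      change sg ε / edgeDiff (isoCoord b (rep κ)) e01 * edgeDiff (isoCoord b (rep κ)) e = _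
      rw [H', H', ← hε]
      field_simp
  rw [← Nat.card_congr (Equiv.ofBijective Ψ hΨ), Nat.card_prod, Nat.card_prod,
    Nat.card_eq_fintype_card (α := Bool), Fintype.card_bool, mul_comm, ← Nat.card_coe_set_eq]

theorem map_edgeDiff {n : ℕ} {G : SimpleGraph (Fin n)} {M N F : Type*} [AddCommGroup M]
    [AddCommGroup N] [FunLike F M N] [AddMonoidHomClass F M N] (f : F)
    (h : Fin n → M) (e : G.edgeSet) : f (edgeDiff h e) = edgeDiff (fun i => f (h i)) e :=
  map_sub f _ _

/-- Two potentials `u`, `v` are the isotropic coordinates `x + iy`, `(x - iy) / 2` of a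
realisation in the plane. -/
def ofPotentials {n : ℕ} (u v : Fin n → ℂ) (i : Fin n) : Fin 2 → ℂ :=
  ![2⁻¹ * u i + v i, Complex.I * (v i - 2⁻¹ * u i)]

theorem ofPotentials_isoCoord {n : ℕ} (p : Fin n → Fin 2 → ℂ) :
    ofPotentials (isoCoord true p) (fun i => 2⁻¹ * isoCoord false p i) = p := by
  funext i k
  fin_cases k
  · simp [ofPotentials, isoCoord]; ring
  · simp [ofPotentials, isoCoord]
    linear_combination (- p i 1) * Complex.I_sq

theorem rigidityMap_ofPotentials {n : ℕ} {G : SimpleGraph (Fin n)} (u v : Fin n → ℂ)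
    (e : G.edgeSet) :
    rigidityMap G 2 (ofPotentials u v) e = edgeDiff u e * edgeDiff v e := by
  have hu : isoCoord true (ofPotentials u v) = u := by
    funext i
    simp [ofPotentials, isoCoord]
    linear_combination (v i - 2⁻¹ * u i) * Complex.I_sq
  have hv : isoCoord (!true) (ofPotentials u v) = fun i => 2 * v i := by
    funext i
    simp [ofPotentials, isoCoord]
    linear_combination (2⁻¹ * u i - v i) * Complex.I_sq
  rw [rigidityMap_eq_isoCoord true, hu, hv]
  simp only [edgeDiff]
  ring

/-- The generic solution of the cycle system: the parameters `a`, `c` are expressed through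
the potentials `X (true, i)` of `y` and `X (false, i)` of `a y⁻¹` and a free scalar. -/
def paramMap {n : ℕ} [NeZero n] (G : SimpleGraph (Fin n)) (h12 : G.Adj 0 1) :
    MvPolynomial (G.edgeSet ⊕ Fin 2) ℂ →ₐ[ℂ] MvPolynomial (Option (Bool × Fin n)) ℂ :=
  MvPolynomial.aeval (Sum.elim
    (fun e => edgeDiff (fun i => MvPolynomial.X (some (true, i))) e *
      edgeDiff (fun i => MvPolynomial.X (some (false, i))) e)
    ![MvPolynomial.X none, -(MvPolynomial.X none *
      edgeDiff (fun i => MvPolynomial.X (some (true, i)))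
        (⟨s(0, 1), G.mem_edgeSet.mpr h12⟩ : G.edgeSet) ^ 2)])

theorem eval_paramMap {n : ℕ} [NeZero n] {G : SimpleGraph (Fin n)} (h12 : G.Adj 0 1)
    (x : Option (Bool × Fin n) → ℂ) (Q : MvPolynomial (G.edgeSet ⊕ Fin 2) ℂ) :
    MvPolynomial.eval x (paramMap G h12 Q) = MvPolynomial.eval (Sum.elim
      (rigidityMap G 2 (ofPotentials (fun i => x (some (true, i))) fun i => x (some (false, i))))
      ![x none, -(x none * edgeDiff (fun i => x (some (true, i)))
        (⟨s(0, 1), G.mem_edgeSet.mpr h12⟩ : G.edgeSet) ^ 2)]) Q := by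
  have h : (MvPolynomial.aeval x).comp (paramMap G h12) = MvPolynomial.aeval (Sum.elim
      (rigidityMap G 2 (ofPotentials (fun i => x (some (true, i))) fun i => x (some (false, i))))
      ![x none, -(x none * edgeDiff (fun i => x (some (true, i)))
        (⟨s(0, 1), G.mem_edgeSet.mpr h12⟩ : G.edgeSet) ^ 2)]) := by
    refine MvPolynomial.algHom_ext fun s => ?_
    rcases s with e | j
    · simp [paramMap, map_edgeDiff, rigidityMap_ofPotentials]
    · fin_cases j <;> simp [paramMap, map_edgeDiff]
  have := congrArg (fun g => g Q) h
  simpa [MvPolynomial.aeval_eq_eval] using this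

theorem edgeDiff_mul_left {n : ℕ} {G : SimpleGraph (Fin n)} {R : Type*} [Ring R] (s : R)
    (h : Fin n → R) (e : G.edgeSet) : edgeDiff (fun i => s * h i) e = s * edgeDiff h e :=
  (mul_sub s _ _).symm

theorem paramMap_injective {n : ℕ} [NeZero n] {G : SimpleGraph (Fin n)} (h12 : G.Adj 0 1)
    (hG : IsMinimallyRigidGraph G 2) : Function.Injective (paramMap G h12) := by
  set e01 : G.edgeSet := ⟨s(0, 1), G.mem_edgeSet.mpr h12⟩ with he01
  refine (injective_iff_map_eq_zero _).mpr fun Q hQ => ?_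
  by_contra hQ0
  have hX : ∀ j : Fin 2, (MvPolynomial.X (Sum.inr j) : MvPolynomial (G.edgeSet ⊕ Fin 2) ℂ) ≠ 0 :=
    fun j => MvPolynomial.X_ne_zero _
  obtain ⟨y, hy⟩ := exists_eval_ne_zero (mul_ne_zero (mul_ne_zero hQ0 (hX 0)) (hX 1))
  simp only [map_mul, MvPolynomial.eval_X, mul_ne_zero_iff] at hy
  obtain ⟨⟨hy, hy0⟩, hy1⟩ := hy
  let Q' : MvPolynomial G.edgeSet ℂ := MvPolynomial.aeval (Sum.elim MvPolynomial.X
    fun j => MvPolynomial.C (y (Sum.inr j))) Q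
  have hev : ∀ z : G.edgeSet → ℂ, MvPolynomial.eval z Q' =
      MvPolynomial.eval (Sum.elim z fun j => y (Sum.inr j)) Q := by
    intro z
    have h : (MvPolynomial.aeval z).comp (MvPolynomial.aeval (Sum.elim MvPolynomial.X
        fun j => MvPolynomial.C (y (Sum.inr j)))) =
        MvPolynomial.aeval (R := ℂ) (Sum.elim z fun j => y (Sum.inr j)) := by
      refine MvPolynomial.algHom_ext fun s => ?_
      rcases s with e | j <;> simp
    have := congrArg (fun g => g Q) h
    simpa [MvPolynomial.aeval_eq_eval, Q'] using this
  have hQ' : Q' ≠ 0 := fun h0 => hy (by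
    have := hev fun e => y (Sum.inl e)
    rw [h0, map_zero] at this
    rw [this]
    congr 2
    funext s
    rcases s with e | j <;> rfl)
  have hA := hG.algebraicIndependent
  have hcomp : MvPolynomial.aeval (lengthPoly G 2) Q' ≠ 0 := fun h0 =>
    hQ' (hA (h0.trans (map_zero _).symm))
  obtain ⟨x, hx⟩ := exists_eval_ne_zero (mul_ne_zero hcomp (hA.ne_zero e01))
  rw [map_mul, mul_ne_zero_iff] at hx
  set p : Fin n → Fin 2 → ℂ := fun i k => x (i, k) with hp
  have h1 : MvPolynomial.eval x (MvPolynomial.aeval (lengthPoly G 2) Q') =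
      MvPolynomial.eval (rigidityMap G 2 p) Q' := by
    have h : (MvPolynomial.aeval x).comp (MvPolynomial.aeval (lengthPoly G 2)) =
        MvPolynomial.aeval (R := ℂ) (rigidityMap G 2 p) := by
      refine MvPolynomial.algHom_ext fun e => ?_
      simpa [MvPolynomial.aeval_eq_eval] using eval_lengthPoly G 2 e p
    have := congrArg (fun g => g Q') h
    simpa [MvPolynomial.aeval_eq_eval] using this
  have h2 : rigidityMap G 2 p e01 ≠ 0 := by
    rw [← eval_lengthPoly]; exact hx.2
  have hU : edgeDiff (isoCoord true p) e01 ≠ 0 := fun h0 => h2 (by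
    rw [rigidityMap_eq_isoCoord true, h0]; simp)
  obtain ⟨t, ht⟩ := IsAlgClosed.exists_pow_nat_eq
    (- y (Sum.inr 1) / (y (Sum.inr 0) * edgeDiff (isoCoord true p) e01 ^ 2)) (n := 2) two_pos
  have ht0 : t ≠ 0 := by
    rintro rfl
    rw [zero_pow two_ne_zero, eq_comm, div_eq_zero_iff, neg_eq_zero] at ht
    exact ht.elim hy1 (mul_ne_zero hy0 (pow_ne_zero 2 hU))
  have h3 := eval_paramMap h12 (fun o => o.elim (y (Sum.inr 0)) fun s =>
    if s.1 then t * isoCoord true p s.2 else t⁻¹ * (2⁻¹ * isoCoord false p s.2)) Q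
  rw [hQ, map_zero] at h3
  refine hx.1 ?_
  rw [h1, hev, h3]
  congr 2
  funext s
  rcases s with e | j
  · simp only [Sum.elim_inl, Option.elim_some, if_true, Bool.false_eq_true, if_false,
      rigidityMap_ofPotentials, edgeDiff_mul_left, rigidityMap_eq_isoCoord true p e, Bool.not_true]
    field_simp
  · fin_cases j
    · simp
    · simp only [Fin.mk_one, Sum.elim_inr, Option.elim_none, Option.elim_some, if_true,
        edgeDiff_mul_left, mul_pow, ht, Matrix.cons_val_one, Matrix.cons_val_fin_one]
      field_simp
      rfl

theorem exists_eval_ne_zero_of_countable {ι k : Type*} [Countable ι] [Field k] [Uncountable k]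
    {σ : Type*} [Finite σ] (f : ι → MvPolynomial σ k) (hf : ∀ i, f i ≠ 0) :
    ∃ x : σ → k, ∀ i, MvPolynomial.eval x (f i) ≠ 0 := by
  have key : ∀ (m : ℕ) (f : ι → MvPolynomial (Fin m) k), (∀ i, f i ≠ 0) →
      ∃ x : Fin m → k, ∀ i, MvPolynomial.eval x (f i) ≠ 0 := by
    intro m
    induction m with
    | zero =>
      refine fun f hf => ⟨Fin.elim0, fun i h => hf i ?_⟩
      exact MvPolynomial.funext fun x => by
        rw [Subsingleton.elim x Fin.elim0, h, map_zero]
    | succ m ih =>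
      intro f hf
      have hf' : ∀ i, MvPolynomial.finSuccEquiv k m (f i) ≠ 0 := fun i => by simpa using hf i
      obtain ⟨x, hx⟩ := ih (fun i => (MvPolynomial.finSuccEquiv k m (f i)).leadingCoeff)
        fun i => Polynomial.leadingCoeff_ne_zero.mpr (hf' i)
      have hg : ∀ i, (MvPolynomial.finSuccEquiv k m (f i)).map (MvPolynomial.eval x) ≠ 0 :=
        fun i h => hx i (by
          have := congrArg (fun g => g.coeff (MvPolynomial.finSuccEquiv k m (f i)).natDegree) h
          simpa using this)
      have hcount : (⋃ i, {y | ((MvPolynomial.finSuccEquiv k m (f i)).map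
          (MvPolynomial.eval x)).IsRoot y}).Countable :=
        Set.countable_iUnion fun i => (Polynomial.finite_setOfPred_isRoot (hg i)).countable
      obtain ⟨y, hy⟩ : ∃ y, y ∉ (⋃ i, {y | ((MvPolynomial.finSuccEquiv k m (f i)).map
          (MvPolynomial.eval x)).IsRoot y}) := by
        by_contra! h
        exact Set.not_countable_univ (hcount.mono fun y _ => h y)
      refine ⟨Fin.cons y x, fun i h => hy (Set.mem_iUnion.mpr ⟨i, ?_⟩)⟩
      rwa [MvPolynomial.eval_eq_eval_mv_eval'] at h
  obtain ⟨m, ⟨e⟩⟩ := Finite.exists_equiv_fin σ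
  obtain ⟨x, hx⟩ := key m (fun i => MvPolynomial.rename e (f i)) fun i h => hf i
    (MvPolynomial.rename_injective e e.injective (h.trans (map_zero _).symm))
  exact ⟨x ∘ e, fun i => by simpa [MvPolynomial.eval_rename] using hx i⟩

/-- There are edge lengths with generic fibre which are, together with two scalars,
algebraically independent over the integers. -/
theorem exists_generic_lengths {n : ℕ} [NeZero n] {G : SimpleGraph (Fin n)} (h12 : G.Adj 0 1)
    (hG : IsMinimallyRigidGraph G 2) {c : ℕ} (hc : IsRealisationNumber G 2 c) :
    ∃ s : G.edgeSet ⊕ Fin 2 → ℂ, AlgebraicIndependent ℤ s ∧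
      (congClasses {q | rigidityMap G 2 q = fun e => s (Sum.inl e)}).ncard = c := by
  obtain ⟨-, f, hf, H⟩ := hc
  let f' : MvPolynomial (Option (Bool × Fin n)) ℂ := MvPolynomial.aeval (fun v : Fin n × Fin 2 =>
    ![MvPolynomial.C 2⁻¹ * MvPolynomial.X (some (true, v.1)) + MvPolynomial.X (some (false, v.1)),
      MvPolynomial.C Complex.I * (MvPolynomial.X (some (false, v.1)) -
        MvPolynomial.C 2⁻¹ * MvPolynomial.X (some (true, v.1)))] v.2) f
  have hf'e : ∀ x, MvPolynomial.eval x f' = MvPolynomial.eval (fun v =>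
      ofPotentials (fun i => x (some (true, i))) (fun i => x (some (false, i))) v.1 v.2) f := by
    intro x
    have h : (MvPolynomial.aeval x).comp (MvPolynomial.aeval (fun v : Fin n × Fin 2 =>
        ![MvPolynomial.C 2⁻¹ * MvPolynomial.X (some (true, v.1)) +
            MvPolynomial.X (some (false, v.1)),
          MvPolynomial.C Complex.I * (MvPolynomial.X (some (false, v.1)) -
            MvPolynomial.C 2⁻¹ * MvPolynomial.X (some (true, v.1)))] v.2)) =
        MvPolynomial.aeval (R := ℂ) (fun v : Fin n × Fin 2 =>
          ofPotentials (fun i => x (some (true, i))) (fun i => x (some (false, i))) v.1 v.2) := by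
      refine MvPolynomial.algHom_ext fun v => ?_
      obtain ⟨i, k⟩ := v
      fin_cases k <;> simp [ofPotentials]
    have := congrArg (fun g => g f) h
    simpa [MvPolynomial.aeval_eq_eval, f'] using this
  have hf' : f' ≠ 0 := by
    obtain ⟨x, hx⟩ := exists_eval_ne_zero hf
    intro h0
    have h1 := hf'e fun o => o.elim 0 fun s =>
      if s.1 then isoCoord true (fun i k => x (i, k)) s.2
      else 2⁻¹ * isoCoord false (fun i k => x (i, k)) s.2
    simp only [Option.elim_some, if_true, Bool.false_eq_true, if_false, h0, map_zero,
      ofPotentials_isoCoord] at h1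
    exact hx h1.symm
  have hZ : Function.Injective (MvPolynomial.map (σ := G.edgeSet ⊕ Fin 2) (algebraMap ℤ ℂ)) :=
    MvPolynomial.map_injective _ (algebraMap ℤ ℂ).injective_int
  have : Countable (MvPolynomial (G.edgeSet ⊕ Fin 2) ℤ) := by
    refine Cardinal.mk_le_aleph0_iff.mp ?_
    refine MvPolynomial.cardinalMk_le_max.trans ?_
    simp
  have : Uncountable ℂ := Cardinal.aleph0_lt_mk_iff.mp (by
    rw [Cardinal.mk_complex]; exact Cardinal.aleph0_lt_continuum)
  obtain ⟨x, hx⟩ := exists_eval_ne_zero_of_countable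
    (fun o : Option {Q : MvPolynomial (G.edgeSet ⊕ Fin 2) ℤ // Q ≠ 0} =>
      o.elim f' fun Q => paramMap G h12 (MvPolynomial.map (algebraMap ℤ ℂ) Q.1))
    (fun o => by
      rcases o with _ | ⟨Q, hQ⟩
      · exact hf'
      · exact fun h => hQ (hZ ((paramMap_injective h12 hG (h.trans (map_zero _).symm)).trans
          (map_zero _).symm)))
  refine ⟨Sum.elim (rigidityMap G 2 (ofPotentials (fun i => x (some (true, i)))
      fun i => x (some (false, i)))) ![x none, -(x none * edgeDiff (fun i => x (some (true, i)))
      (⟨s(0, 1), G.mem_edgeSet.mpr h12⟩ : G.edgeSet) ^ 2)],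
    (injective_iff_map_eq_zero _).mpr fun Q hQ => ?_, H _ (by simpa [hf'e] using hx none)⟩
  by_contra hQ0
  refine hx (some ⟨Q, hQ0⟩) ?_
  rw [Option.elim_some, eval_paramMap, MvPolynomial.eval_map, ← MvPolynomial.aeval_def]
  exact hQ

/-- Generic lengths are not attained by a collinear framework on a graph with at least as many
edges as vertices. -/
theorem AlgebraicIndependent.exists_ne_edgeDiff_sq {n : ℕ} [NeZero n] {G : SimpleGraph (Fin n)}
    (hn : n ≤ Nat.card G.edgeSet) {a : G.edgeSet → ℂ} (ha : AlgebraicIndependent ℤ a)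
    (h : Fin n → ℂ) : ∃ e : G.edgeSet, a e ≠ edgeDiff h e ^ 2 := by
  by_contra! H
  let Y : Fin n → MvPolynomial {i : Fin n // i ≠ 0} ℤ := fun i =>
    if hi : i ≠ 0 then MvPolynomial.X ⟨i, hi⟩ else 0
  let φ : MvPolynomial {i : Fin n // i ≠ 0} ℤ →ₐ[ℤ] ℂ := MvPolynomial.aeval fun i => h i - h 0
  have hφ : ∀ i, φ (Y i) = h i - h 0 := fun i => by
    by_cases hi : i = 0
    · simp [Y, hi]
    · simp [Y, hi, φ]
  have hcomp : a = φ ∘ fun e => edgeDiff Y e ^ 2 := by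
    funext e
    rw [Function.comp_apply, map_pow, map_edgeDiff, H e]
    simp [edgeDiff, hφ]
  rw [hcomp] at ha
  have h1 := (_root_.AlgebraicIndependent.of_comp φ ha).lift_cardinalMk_le_trdeg
  rw [MvPolynomial.trdeg_of_isDomain] at h1
  simp only [← Nat.cast_card, Cardinal.lift_natCast, Nat.cast_le] at h1
  have h2 : Nat.card {i : Fin n // i ≠ 0} < n := by
    simpa using Fintype.card_subtype_lt (p := fun i : Fin n => i ≠ 0) (x := 0) (by simp)
  omega

open Cardinal in
theorem exists_algEquiv_of_mk_eq {R K L : Type} [CommRing R] [Countable R] [Field K] [Field L]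
    [Algebra R K] [Algebra R L] [FaithfulSMul R K] [FaithfulSMul R L] [IsAlgClosed K]
    [IsAlgClosed L] (hK : ℵ₀ < #K) (hKL : #K = #L) : Nonempty (K ≃ₐ[R] L) := by
  have : Nontrivial R := (algebraMap R K).domain_nontrivial
  obtain ⟨s, hs⟩ := exists_isTranscendenceBasis R K
  obtain ⟨t, ht⟩ := exists_isTranscendenceBasis R L
  have hR : #R ≤ ℵ₀ := mk_le_aleph0
  have hst : #s = #t := by
    rw [← IsAlgClosed.cardinal_eq_cardinal_transcendence_basis_of_aleph0_lt' _ hs hR hK, hKL,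
      IsAlgClosed.cardinal_eq_cardinal_transcendence_basis_of_aleph0_lt' _ ht hR (hKL ▸ hK)]
  obtain ⟨e⟩ := Cardinal.eq.mp hst
  let := IsAlgClosed.isAlgClosure_of_transcendence_basis _ hs
  let := IsAlgClosed.isAlgClosure_of_transcendence_basis _ ht
  let e' : Algebra.adjoin R (Set.range ((↑) : s → K)) ≃ₐ[R]
      Algebra.adjoin R (Set.range ((↑) : t → L)) :=
    (hs.1.aevalEquiv.symm.trans (MvPolynomial.renameEquiv R e)).trans ht.1.aevalEquiv
  refine ⟨AlgEquiv.ofRingEquiv (f := IsAlgClosure.equivOfEquiv K L e'.toRingEquiv) fun r => ?_⟩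
  have h := IsAlgClosure.equivOfEquiv_algebraMap K L e'.toRingEquiv (algebraMap R _ r)
  rw [← IsScalarTower.algebraMap_apply] at h
  rw [h]
  change algebraMap _ L (e' (algebraMap R _ r)) = _
  rw [e'.commutes, ← IsScalarTower.algebraMap_apply]

open Cardinal in
theorem exists_ringEquiv_of_algebraicIndependent {P K L : Type} [Finite P] [Field K] [Field L]
    [IsAlgClosed K] [IsAlgClosed L] (hK : ℵ₀ < #K) (hKL : #K = #L) {x : P → K} {y : P → L}
    (hx : AlgebraicIndependent ℤ x) (hy : AlgebraicIndependent ℤ y) :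
    ∃ σ : K ≃+* L, ∀ i, σ (x i) = y i := by
  let := (MvPolynomial.aeval (R := ℤ) x).toRingHom.toAlgebra
  let := (MvPolynomial.aeval (R := ℤ) y).toRingHom.toAlgebra
  have : Countable (MvPolynomial P ℤ) := by
    refine Cardinal.mk_le_aleph0_iff.mp ?_
    refine MvPolynomial.cardinalMk_le_max.trans ?_
    simp
  have : FaithfulSMul (MvPolynomial P ℤ) K := (faithfulSMul_iff_algebraMap_injective _ _).mpr hx
  have : FaithfulSMul (MvPolynomial P ℤ) L := (faithfulSMul_iff_algebraMap_injective _ _).mpr hy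
  obtain ⟨σ⟩ := exists_algEquiv_of_mk_eq (R := MvPolynomial P ℤ) hK hKL
  refine ⟨σ.toRingEquiv, fun i => ?_⟩
  have h := σ.commutes (MvPolynomial.X i)
  have h1 : algebraMap (MvPolynomial P ℤ) K (MvPolynomial.X i) = x i :=
    MvPolynomial.aeval_X x i
  have h2 : algebraMap (MvPolynomial P ℤ) L (MvPolynomial.X i) = y i :=
    MvPolynomial.aeval_X y i
  rw [h1, h2] at h
  exact h

open Cardinal in
theorem mk_of_isFractionRing_of_isAlgebraic (P : Type) [Finite P] {K k : Type} [Field K]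
    [Algebra (MvPolynomial P ℂ) K] [IsFractionRing (MvPolynomial P ℂ) K] [Field k] [Algebra K k]
    [Algebra.IsAlgebraic K k] : #k = 𝔠 := by
  refine le_antisymm ?_ ?_
  · refine (Algebra.IsAlgebraic.cardinalMk_le_max K _).trans ?_
    refine max_le ?_ aleph0_le_continuum
    refine (IsLocalization.cardinalMk_le (S := nonZeroDivisors (MvPolynomial P ℂ))).trans ?_
    refine MvPolynomial.cardinalMk_le_max.trans ?_
    simp [aleph0_le_continuum, mk_complex, (mk_le_aleph0 (α := P)).trans aleph0_le_continuum]
  · rw [← mk_complex]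
    exact mk_le_of_injective
      (((algebraMap K k).comp ((algebraMap (MvPolynomial P ℂ) K).comp MvPolynomial.C)).injective)

theorem algebraicIndependent_algebraMap_X (P : Type) {K k : Type} [Field K]
    [Algebra (MvPolynomial P ℂ) K] [IsFractionRing (MvPolynomial P ℂ) K] [Field k] [Algebra K k] :
    AlgebraicIndependent ℤ fun s : P =>
      algebraMap K k (algebraMap (MvPolynomial P ℂ) K (MvPolynomial.X s)) :=
  ((MvPolynomial.algebraicIndependent_X P ℂ).restrictScalars (R := ℤ)
    (algebraMap ℤ ℂ).injective_int).map'
      (f := ((algebraMap K k).comp (algebraMap (MvPolynomial P ℂ) K)).toIntAlgHom)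
      ((algebraMap K k).injective.comp (IsFractionRing.injective (MvPolynomial P ℂ) K))

theorem cycleSolutions_map {n : ℕ} [NeZero n] {G : SimpleGraph (Fin n)} (h12 : G.Adj 0 1)
    {k l : Type*} [Field k] [Field l] (σ : k ≃+* l) {a : G.edgeSet → k} {c : Fin 2 → k}
    {y : G.edgeSet → k} (hy : y ∈ cycleSolutions G h12 a c) :
    (fun e => σ (y e)) ∈ cycleSolutions G h12 (fun e => σ (a e)) fun j => σ (c j) := by
  obtain ⟨h0, h1, h2, h3⟩ := hy
  refine ⟨fun e => by simpa using h0 e, fun v w hw => ?_, fun v w hw => ?_, ?_⟩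
  · have := congrArg σ (h1 v w hw)
    rw [map_list_sum, List.map_map, map_zero] at this
    simpa [Function.comp_def, map_signedVal] using this
  · have := congrArg σ (h2 v w hw)
    rw [map_list_sum, List.map_map, map_zero] at this
    simpa [Function.comp_def, map_signedVal] using this
  · simpa using congrArg σ h3

theorem card_cycleSolutions_map {n : ℕ} [NeZero n] {G : SimpleGraph (Fin n)} (h12 : G.Adj 0 1)
    {k l : Type*} [Field k] [Field l] (σ : k ≃+* l) (a : G.edgeSet → k) (c : Fin 2 → k) :
    Nat.card (cycleSolutions G h12 (fun e => σ (a e)) fun j => σ (c j)) =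
      Nat.card (cycleSolutions G h12 a c) :=
  Nat.card_congr
    { toFun := fun y => ⟨fun e => σ.symm (y.1 e), by
        simpa using cycleSolutions_map h12 σ.symm y.2⟩
      invFun := fun y => ⟨fun e => σ (y.1 e), cycleSolutions_map h12 σ y.2⟩
      left_inv := fun y => by simp
      right_inv := fun y => by simp }

/-- Over an algebraically closed field with the cardinality of `ℂ`, the cycle system with
algebraically independent parameters has `4 c` solutions. -/
theorem card_cycleSolutions_of_algebraicIndependent {n : ℕ} [NeZero n] (hn : 3 ≤ n)
    {G : SimpleGraph (Fin n)} (h12 : G.Adj 0 1) (hG : IsMinimallyRigidGraph G 2) {c : ℕ}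
    (hc : IsRealisationNumber G 2 c) {k : Type} [Field k] [IsAlgClosed k]
    (hk : Cardinal.mk k = Cardinal.continuum) {x : G.edgeSet ⊕ Fin 2 → k}
    (hx : AlgebraicIndependent ℤ x) :
    Nat.card (cycleSolutions G h12 (fun e => x (Sum.inl e)) fun j => x (Sum.inr j)) = 4 * c := by
  obtain ⟨s, hs, hcard⟩ := exists_generic_lengths h12 hG hc
  obtain ⟨σ, hσ⟩ := exists_ringEquiv_of_algebraicIndependent
    (hk ▸ Cardinal.aleph0_lt_continuum) (hk.trans Cardinal.mk_complex.symm) hx hs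
  have h0 : ∀ i, s i ≠ 0 := hs.ne_zero
  rw [← card_cycleSolutions_map h12 σ]
  simp only [hσ]
  rw [card_cycleSolutions hG.1.connected h12 (fun e => h0 _) (h0 _) (h0 _), hcard]
  exact AlgebraicIndependent.exists_ne_edgeDiff_sq (hG.1.card_le_card_edges hn)
    (hs.comp _ Sum.inl_injective)

theorem LX_mul_LXinv {K V : Type*} [CommRing K] (v : V) :
    (LX v : LaurentRing K V) * LXinv v = 1 := by
  simp [LX, LXinv, AddMonoidAlgebra.single_mul_single, AddMonoidAlgebra.one_def]

theorem adjoin_LX_LXinv (K V : Type*) [CommRing K] :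
    Algebra.adjoin K (Set.range (LX : V → LaurentRing K V) ∪ Set.range LXinv) = ⊤ := by
  set S := Algebra.adjoin K (Set.range (LX : V → LaurentRing K V) ∪ Set.range LXinv)
  have h1 : ∀ v : V, LX v ∈ S := fun v => Algebra.subset_adjoin (Or.inl ⟨v, rfl⟩)
  have h2 : ∀ v : V, LXinv v ∈ S := fun v => Algebra.subset_adjoin (Or.inr ⟨v, rfl⟩)
  have hadd : ∀ x y : V →₀ ℤ, (AddMonoidAlgebra.single (x + y) 1 : LaurentRing K V) =
      AddMonoidAlgebra.single x 1 * AddMonoidAlgebra.single y 1 := fun x y => by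
    rw [AddMonoidAlgebra.single_mul_single, one_mul]
  have h3 : ∀ x : V →₀ ℤ, (AddMonoidAlgebra.single x 1 : LaurentRing K V) ∈ S := by
    intro x
    induction x using Finsupp.induction_linear with
    | zero => exact S.one_mem
    | add x y hx hy => exact hadd x y ▸ S.mul_mem hx hy
    | single v m =>
      induction m using Int.induction_on with
      | zero => rw [Finsupp.single_zero]; exact S.one_mem
      | succ i hi => rw [Finsupp.single_add, hadd]; exact S.mul_mem hi (h1 v)
      | pred i hi =>
        rw [sub_eq_add_neg, Finsupp.single_add, hadd]
        exact S.mul_mem hi (h2 v)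
  refine eq_top_iff.mpr fun f _ => ?_
  induction f using AddMonoidAlgebra.induction_linear with
  | zero => exact S.zero_mem
  | add f g hf hg => exact S.add_mem (hf trivial) (hg trivial)
  | single x r =>
    have : (AddMonoidAlgebra.single x r : LaurentRing K V) =
        r • AddMonoidAlgebra.single x 1 := by
      simp
    rw [this]
    exact S.smul_mem (h3 x) r

/-- Evaluation of Laurent polynomials at units. -/
def laurentEval {K V A : Type*} [CommRing K] [CommRing A] [Algebra K A] (y : V → Aˣ) :
    LaurentRing K V →ₐ[K] A :=
  AddMonoidAlgebra.lift K A (V →₀ ℤ) ((Units.coeHom A).comp (AddMonoidHom.toMultiplicativeLeft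
    (Finsupp.liftAddHom fun v => zmultiplesHom (Additive Aˣ) (Additive.ofMul (y v)))))

theorem laurentEval_LX {K V A : Type*} [CommRing K] [CommRing A] [Algebra K A] (y : V → Aˣ)
    (v : V) : laurentEval (K := K) y (LX v) = y v := by
  simp [laurentEval, LX]

theorem laurentEval_LXinv {K V A : Type*} [CommRing K] [CommRing A] [Algebra K A] (y : V → Aˣ)
    (v : V) : laurentEval (K := K) y (LXinv v) = ((y v)⁻¹ : Aˣ) := by
  have h := congrArg (laurentEval (K := K) y) (LX_mul_LXinv v)
  rw [map_mul, laurentEval_LX, map_one] at h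
  exact (Units.inv_eq_of_mul_eq_one_right h).symm

/-- The ideal of the cycle system with parameters `a`, `c`. -/
def cycleIdeal {n : ℕ} [NeZero n] (G : SimpleGraph (Fin n)) (h12 : G.Adj 0 1) {K : Type*}
    [CommRing K] (a : G.edgeSet → K) (c : Fin 2 → K) : Ideal (LaurentRing K ↥G.edgeSet) :=
  Ideal.span (
    {g | ∃ (v : Fin n) (w : G.Walk v v), w.IsCycle ∧
      g = (w.darts.map fun d => ydirE K d).sum} ∪
    {g | ∃ (v : Fin n) (w : G.Walk v v), w.IsCycle ∧
      g = (w.darts.map fun d => algebraMap _ _ (a ⟨d.edge, d.edge_mem⟩) * ydirEinv K d).sum} ∪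
    {g | g = algebraMap _ _ (c 0) * (LX (⟨s(0, 1), G.mem_edgeSet.mpr h12⟩ : ↥G.edgeSet)) ^ 2 +
      algebraMap _ _ (c 1)})

/-- The coordinate ring of the cycle system. -/
abbrev CycleRing {n : ℕ} [NeZero n] (G : SimpleGraph (Fin n)) (h12 : G.Adj 0 1) {K : Type*}
    [CommRing K] (a : G.edgeSet → K) (c : Fin 2 → K) : Type _ :=
  LaurentRing K ↥G.edgeSet ⧸ cycleIdeal G h12 a c

section CycleRing

variable {n : ℕ} [NeZero n] {G : SimpleGraph (Fin n)} {h12 : G.Adj 0 1} {K : Type*}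
    [Field K] {a : G.edgeSet → K} {c : Fin 2 → K}

/-- The class of a Laurent variable. -/
def cycleVar (e : G.edgeSet) : CycleRing G h12 a c := Ideal.Quotient.mkₐ K _ (LX e)

/-- The class of an inverse Laurent variable. -/
def cycleVarInv (e : G.edgeSet) : CycleRing G h12 a c := Ideal.Quotient.mkₐ K _ (LXinv e)

theorem cycleVar_mul_cycleVarInv (e : G.edgeSet) :
    (cycleVar e : CycleRing G h12 a c) * cycleVarInv e = 1 := by
  rw [cycleVar, cycleVarInv, ← map_mul, LX_mul_LXinv, map_one]

theorem sum_signedVal_cycleVar {v : Fin n} {w : G.Walk v v} (hw : w.IsCycle) :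
    (w.darts.map fun d => signedVal (cycleVar : _ → CycleRing G h12 a c) d).sum = 0 := by
  have h : (w.darts.map fun d => ydirE K d).sum ∈ cycleIdeal G h12 a c :=
    Ideal.subset_span (Or.inl (Or.inl ⟨v, w, hw, rfl⟩))
  have := Ideal.Quotient.eq_zero_iff_mem.mpr h
  rw [map_list_sum, List.map_map] at this
  rw [← this]
  congr 2
  funext d
  exact (map_signedVal (Ideal.Quotient.mk (cycleIdeal G h12 a c)) LX d).symm

theorem sum_signedVal_cycleVarInv {v : Fin n} {w : G.Walk v v} (hw : w.IsCycle) :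
    (w.darts.map fun d => signedVal (fun e => algebraMap K (CycleRing G h12 a c) (a e) *
      cycleVarInv e) d).sum = 0 := by
  have h : (w.darts.map fun d => algebraMap K (LaurentRing K ↥G.edgeSet) (a ⟨d.edge, d.edge_mem⟩) *
      ydirEinv K d).sum ∈ cycleIdeal G h12 a c :=
    Ideal.subset_span (Or.inl (Or.inr ⟨v, w, hw, rfl⟩))
  have := Ideal.Quotient.eq_zero_iff_mem.mpr h
  rw [map_list_sum, List.map_map] at this
  rw [← this]
  congr 2
  funext d
  rw [← mul_signedVal (fun e => algebraMap K (CycleRing G h12 a c) (a e)), Function.comp_apply,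
    map_mul]
  congr 1
  exact (map_signedVal (Ideal.Quotient.mk (cycleIdeal G h12 a c)) LXinv d).symm

theorem cycleVar_sq_add :
    algebraMap K (CycleRing G h12 a c) (c 0) *
      cycleVar ⟨s(0, 1), G.mem_edgeSet.mpr h12⟩ ^ 2 + algebraMap K _ (c 1) = 0 := by
  have h : algebraMap K (LaurentRing K ↥G.edgeSet) (c 0) *
      (LX (⟨s(0, 1), G.mem_edgeSet.mpr h12⟩ : ↥G.edgeSet)) ^ 2 + algebraMap _ _ (c 1) ∈
      cycleIdeal G h12 a c := Ideal.subset_span (Or.inr rfl)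
  have := Ideal.Quotient.eq_zero_iff_mem.mpr h
  rwa [map_add, map_mul, map_pow] at this

theorem adjoin_cycleVar : Algebra.adjoin K
    (Set.range (cycleVar : _ → CycleRing G h12 a c) ∪ Set.range cycleVarInv) = ⊤ := by
  have h := congrArg (Subalgebra.map (Ideal.Quotient.mkₐ K (cycleIdeal G h12 a c)))
    (adjoin_LX_LXinv K G.edgeSet)
  rw [AlgHom.map_adjoin, Set.image_union, ← Set.range_comp, ← Set.range_comp, Algebra.map_top,
    (AlgHom.range_eq_top _).mpr (Ideal.Quotient.mkₐ_surjective _ _)] at h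
  exact h

instance : Algebra.FiniteType K (CycleRing G h12 a c) :=
  ⟨Subalgebra.fg_def.mpr ⟨_, (Set.finite_range _).union (Set.finite_range _), adjoin_cycleVar⟩⟩

variable {k : Type*} [Field k] [Algebra K k]

theorem map_cycleVarInv (φ : CycleRing G h12 a c →ₐ[K] k) (e : G.edgeSet) :
    φ (cycleVarInv e) = (φ (cycleVar e))⁻¹ := by
  refine eq_inv_of_mul_eq_one_right ?_
  rw [← map_mul, cycleVar_mul_cycleVarInv, map_one]

theorem map_cycleVar_mem (φ : CycleRing G h12 a c →ₐ[K] k) :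
    (fun e => φ (cycleVar e)) ∈ cycleSolutions G h12 (fun e => algebraMap K k (a e))
      fun j => algebraMap K k (c j) := by
  refine ⟨fun e h => ?_, fun v w hw => ?_, fun v w hw => ?_, ?_⟩
  · have := congrArg φ (cycleVar_mul_cycleVarInv (h12 := h12) (a := a) (c := c) e)
    rw [map_mul, show φ (cycleVar e) = 0 from h, zero_mul, map_one] at this
    exact zero_ne_one this
  · have := congrArg φ (sum_signedVal_cycleVar (h12 := h12) (a := a) (c := c) hw)
    rw [map_list_sum, List.map_map, map_zero] at this
    simpa [Function.comp_def, map_signedVal] using this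
  · have := congrArg φ (sum_signedVal_cycleVarInv (h12 := h12) (a := a) (c := c) hw)
    rw [map_list_sum, List.map_map, map_zero] at this
    simp only [mul_signedVal fun e => algebraMap K k (a e)]
    simpa [Function.comp_def, map_signedVal, map_cycleVarInv] using this
  · simpa using congrArg φ (cycleVar_sq_add (h12 := h12) (a := a) (c := c))

theorem cycleRing_algHom_ext {φ ψ : CycleRing G h12 a c →ₐ[K] k}
    (h : ∀ e, φ (cycleVar e) = ψ (cycleVar e)) : φ = ψ := by
  refine AlgHom.ext_of_adjoin_eq_top adjoin_cycleVar ?_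
  rintro _ (⟨e, rfl⟩ | ⟨e, rfl⟩)
  · exact h e
  · rw [map_cycleVarInv, map_cycleVarInv, h]

theorem exists_cycleRing_algHom {y : G.edgeSet → k}
    (hy : y ∈ cycleSolutions G h12 (fun e => algebraMap K k (a e)) fun j => algebraMap K k (c j)) :
    ∃ φ : CycleRing G h12 a c →ₐ[K] k, ∀ e, φ (cycleVar e) = y e := by
  obtain ⟨h0, h1, h2, h3⟩ := hy
  let ev : LaurentRing K ↥G.edgeSet →ₐ[K] k := laurentEval fun e => Units.mk0 (y e) (h0 e)
  have hev : ∀ e, ev (LX e) = y e := fun e => laurentEval_LX _ e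
  have hev' : ∀ e, ev (LXinv e) = (y e)⁻¹ := fun e => laurentEval_LXinv _ e
  have hker : ∀ g ∈ cycleIdeal G h12 a c, ev g = 0 := by
    intro g hg
    refine (Ideal.span_le (I := RingHom.ker ev)).mpr ?_ hg
    rintro _ ((⟨v, w, hw, rfl⟩ | ⟨v, w, hw, rfl⟩) | rfl)
    · refine Eq.trans ?_ (h1 v w hw)
      rw [map_list_sum, List.map_map]
      congr 2
      funext d
      exact (map_signedVal ev LX d).trans (by simp only [hev])
    · refine Eq.trans ?_ (h2 v w hw)
      rw [map_list_sum, List.map_map]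
      congr 2
      funext d
      rw [Function.comp_apply, map_mul, AlgHom.commutes]
      congr 1
      exact (map_signedVal ev LXinv d).trans (by simp only [hev'])
    · refine Eq.trans ?_ h3
      rw [map_add, map_mul, map_pow, hev, AlgHom.commutes, AlgHom.commutes]
  exact ⟨Ideal.Quotient.liftₐ _ ev hker, hev⟩

variable (h12 a c k) in
theorem card_cycleRing_algHom : Nat.card (CycleRing G h12 a c →ₐ[K] k) =
    Nat.card (cycleSolutions G h12 (fun e => algebraMap K k (a e)) fun j => algebraMap K k (c j)) :=
  Nat.card_congr (Equiv.ofBijective (fun φ => ⟨_, map_cycleVar_mem φ⟩)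
    ⟨fun _ _ h => cycleRing_algHom_ext fun e => congrFun (congrArg Subtype.val h) e, fun y =>
      (exists_cycleRing_algHom y.2).imp fun _ h => Subtype.ext (funext h)⟩)

end CycleRing

/-- A finitely generated domain over a field of characteristic zero with finitely many geometric
points is a finite field extension, of degree the number of these points. -/
theorem finrank_eq_card_algHom {K B k : Type*} [Field K] [CharZero K] [CommRing B] [IsDomain B]
    [Algebra K B] [Algebra.FiniteType K B] [Field k] [Algebra K k] [IsAlgClosed k]
    [Finite (B →ₐ[K] k)] : Module.finrank K B = Nat.card (B →ₐ[K] k) := by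
  have hpt : ∀ m : MaximalSpectrum B, ∃ φ : B →ₐ[K] k, RingHom.ker φ = m.asIdeal := by
    intro m
    have := m.isMaximal
    let := Ideal.Quotient.field m.asIdeal
    have : Module.Finite K (B ⧸ m.asIdeal) := finite_of_finite_type_of_isJacobsonRing K _
    refine ⟨(IsAlgClosed.lift : B ⧸ m.asIdeal →ₐ[K] k).comp (Ideal.Quotient.mkₐ K m.asIdeal), ?_⟩
    ext b
    rw [RingHom.mem_ker, AlgHom.comp_apply, map_eq_zero]
    exact Ideal.Quotient.eq_zero_iff_mem
  choose pt hpt using hpt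
  have : Finite (MaximalSpectrum B) := Finite.of_injective pt fun m m' h =>
    MaximalSpectrum.ext (by rw [← hpt, ← hpt, h])
  have := Fintype.ofFinite (MaximalSpectrum B)
  have : IsJacobsonRing B := isJacobsonRing_of_finiteType (A := K)
  have hbot : ∏ m : MaximalSpectrum B, m.asIdeal ≤ (⊥ : Ideal B) := by
    have h : (⊥ : Ideal B).jacobson = ⊥ :=
      IsJacobsonRing.out inferInstance Ideal.isPrime_bot.isRadical
    rw [← h]
    refine le_sInf fun m hm => ?_
    exact Ideal.prod_le_inf.trans (Finset.inf_le (Finset.mem_univ (⟨m, hm.2⟩ : MaximalSpectrum B)))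
  obtain ⟨m, -, hm⟩ := (Ideal.IsPrime.prod_le Ideal.isPrime_bot).mp hbot
  have hfield : IsField B := by
    rw [Ring.isField_iff_maximal_bot]
    exact le_bot_iff.mp hm ▸ m.isMaximal
  let := hfield.toField
  have : Module.Finite K B := finite_of_finite_type_of_isJacobsonRing K _
  have := AlgHom.card K B k
  rw [← this, Nat.card_eq_fintype_card]

/-- The coordinate ring of the generic cycle system is a domain: it embeds into the field of
rational functions in the potentials of a generic solution. -/
theorem isDomain_cycleRing {n : ℕ} [NeZero n] {G : SimpleGraph (Fin n)} (h12 : G.Adj 0 1)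
    (hG : IsMinimallyRigidGraph G 2) {K : Type*} [Field K]
    [Algebra (MvPolynomial (G.edgeSet ⊕ Fin 2) ℂ) K]
    [IsFractionRing (MvPolynomial (G.edgeSet ⊕ Fin 2) ℂ) K] :
    IsDomain (CycleRing G h12
      (fun e => algebraMap (MvPolynomial (G.edgeSet ⊕ Fin 2) ℂ) K (MvPolynomial.X (Sum.inl e)))
      fun j => algebraMap (MvPolynomial (G.edgeSet ⊕ Fin 2) ℂ) K (MvPolynomial.X (Sum.inr j))) := by
  set R := MvPolynomial (G.edgeSet ⊕ Fin 2) ℂ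
  set D := MvPolynomial (Option (Bool × Fin n)) ℂ
  let F := FractionRing D
  set a : G.edgeSet → K := fun e => algebraMap R K (MvPolynomial.X (Sum.inl e))
  set c : Fin 2 → K := fun j => algebraMap R K (MvPolynomial.X (Sum.inr j))
  let B := CycleRing G h12 a c
  have hconn := hG.1.connected
  let ι : D →+* F := algebraMap D F
  have hι : Function.Injective ι := IsFractionRing.injective D F
  have hθ : Function.Injective (ι.comp (paramMap G h12).toRingHom) :=
    hι.comp (paramMap_injective h12 hG)
  let : Algebra K F := (IsFractionRing.lift hθ : K →+* F).toAlgebra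
  have hKF : ∀ r : R, algebraMap K F (algebraMap R K r) = ι (paramMap G h12 r) := fun r =>
    IsFractionRing.lift_algebraMap hθ r
  let u : Fin n → D := fun i => MvPolynomial.X (some (true, i))
  let v : Fin n → D := fun i => MvPolynomial.X (some (false, i))
  let γ : D := MvPolynomial.X none
  have hpa : ∀ e, paramMap G h12 (MvPolynomial.X (Sum.inl e)) = edgeDiff u e * edgeDiff v e :=
    fun e => MvPolynomial.aeval_X _ _
  have hpc0 : paramMap G h12 (MvPolynomial.X (Sum.inr 0)) = γ := MvPolynomial.aeval_X _ _
  have hpc1 : paramMap G h12 (MvPolynomial.X (Sum.inr 1)) =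
      -(γ * edgeDiff u (⟨s(0, 1), G.mem_edgeSet.mpr h12⟩ : G.edgeSet) ^ 2) :=
    MvPolynomial.aeval_X _ _
  have haF : ∀ e, algebraMap K F (a e) = ι (edgeDiff u e * edgeDiff v e) := fun e => by
    rw [← hpa]; exact hKF _
  have haF0 : ∀ e, algebraMap K F (a e) ≠ 0 := fun e => by
    rw [map_ne_zero]
    exact (map_ne_zero_iff _ (IsFractionRing.injective R K)).mpr (MvPolynomial.X_ne_zero _)
  have hsol : (fun e => ι (edgeDiff u e)) ∈ cycleSolutions G h12
      (fun e => algebraMap K F (a e)) fun j => algebraMap K F (c j) := by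
    refine (mem_cycleSolutions_iff hconn h12 haF0).mpr
      ⟨fun i => ι (u i), fun i => ι (v i), funext fun e => map_edgeDiff ι u e, fun e => ?_, ?_⟩
    · rw [haF, map_mul, map_edgeDiff ι u, map_edgeDiff ι v]
    · have h0 : algebraMap K F (c 0) = ι γ := by rw [← hpc0]; exact hKF _
      have h1 : algebraMap K F (c 1) = _ := (hKF _).trans (congrArg ι hpc1)
      rw [h0, h1, ← map_pow, ← map_mul, ← map_add, add_neg_cancel, map_zero]
  obtain ⟨φ, hφ⟩ := exists_cycleRing_algHom hsol
  obtain ⟨hu, hu0, hu'⟩ := exists_potential hconn (signedVal_symm (cycleVar : _ → B))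
    (fun _ _ hw => sum_signedVal_cycleVar hw) 0
  obtain ⟨hv, hv0, hv'⟩ := exists_potential hconn
    (signedVal_symm (fun e => algebraMap K B (a e) * cycleVarInv e))
    (fun _ _ hw => sum_signedVal_cycleVarInv hw) 0
  replace hu' : (cycleVar : _ → B) = edgeDiff hu := eq_edgeDiff_of_signedVal hu'
  replace hv' : (fun e => algebraMap K B (a e) * cycleVarInv e) = edgeDiff hv :=
    eq_edgeDiff_of_signedVal hv'
  let β : R →+* B := (algebraMap K B).comp (algebraMap R K)
  let ψ : D →+* B := MvPolynomial.eval₂Hom (β.comp MvPolynomial.C) fun o =>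
    o.elim (algebraMap K B (c 0)) fun s => if s.1 then hu s.2 else hv s.2
  have hψu : ∀ i, ψ (u i) = hu i := fun i => MvPolynomial.eval₂Hom_X' _ _ _
  have hψv : ∀ i, ψ (v i) = hv i := fun i => MvPolynomial.eval₂Hom_X' _ _ _
  have hψγ : ψ γ = algebraMap K B (c 0) := MvPolynomial.eval₂Hom_X' _ _ _
  have hψC : ∀ z, ψ (MvPolynomial.C z) = β (MvPolynomial.C z) := fun z =>
    MvPolynomial.eval₂Hom_C _ _ _
  have hψu' : ∀ e, ψ (edgeDiff u e) = cycleVar e := fun e => by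
    rw [map_edgeDiff, hu']; simp only [hψu]
  have hψv' : ∀ e, ψ (edgeDiff v e) = algebraMap K B (a e) * cycleVarInv e := fun e => by
    rw [map_edgeDiff, congrFun hv' e]; simp only [hψv]
  have hψθ : ∀ r : R, ψ (paramMap G h12 r) = β r := by
    have : ψ.comp (paramMap G h12).toRingHom = β := by
      refine MvPolynomial.ringHom_ext (fun z => ?_) fun s => ?_
      · exact (congrArg ψ ((paramMap G h12).commutes z)).trans (hψC z)
      · rcases s with e | j
        · refine (congrArg ψ (hpa e)).trans ?_
          rw [map_mul, hψu', hψv', mul_left_comm, cycleVar_mul_cycleVarInv, mul_one]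
          rfl
        · fin_cases j
          · exact (congrArg ψ hpc0).trans hψγ
          · refine (congrArg ψ hpc1).trans ?_
            rw [map_neg, map_mul, map_pow, hψγ, hψu']
            exact neg_eq_of_add_eq_zero_right cycleVar_sq_add
    exact fun r => congrArg (fun g => g r) this
  let τ : D →+* D := MvPolynomial.eval₂Hom MvPolynomial.C fun o =>
    o.elim γ fun s => MvPolynomial.X (some s) - MvPolynomial.X (some (s.1, 0))
  have hτu : ∀ i, τ (u i) = u i - u 0 := fun i => MvPolynomial.eval₂Hom_X' _ _ _
  have hτv : ∀ i, τ (v i) = v i - v 0 := fun i => MvPolynomial.eval₂Hom_X' _ _ _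
  have hτγ : τ γ = γ := MvPolynomial.eval₂Hom_X' _ _ _
  have hτC : ∀ z, τ (MvPolynomial.C z) = MvPolynomial.C z := fun z => MvPolynomial.eval₂Hom_C _ _ _
  have hψτ : ∀ d, ψ (τ d) = ψ d := by
    have : ψ.comp τ = ψ := by
      refine MvPolynomial.ringHom_ext (fun z => congrArg ψ (hτC z)) fun o => ?_
      rcases o with _ | ⟨_ | _, i⟩
      · exact congrArg ψ hτγ
      · change ψ (τ (v i)) = ψ (v i)
        rw [hτv, map_sub, hψv, hψv, hv0, sub_zero]
      · change ψ (τ (u i)) = ψ (u i)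
        rw [hτu, map_sub, hψu, hψu, hu0, sub_zero]
    exact fun d => congrArg (fun g => g d) this
  have hφu : ∀ i, φ (hu i) = ι (u i) - ι (u 0) := fun i => by
    have := sub_eq_sub_of_edgeDiff_eq hconn (g := fun i => φ (hu i)) (h := fun i => ι (u i))
      (fun e => by rw [← map_edgeDiff, ← map_edgeDiff, ← hu', hφ]) i 0
    rwa [hu0, map_zero, sub_zero] at this
  have hφv : ∀ i, φ (hv i) = ι (v i) - ι (v 0) := fun i => by
    have := sub_eq_sub_of_edgeDiff_eq hconn (g := fun i => φ (hv i)) (h := fun i => ι (v i))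
      (fun e => by
        have h0 := haF0 e
        rw [haF, map_mul, mul_ne_zero_iff] at h0
        rw [← map_edgeDiff, ← map_edgeDiff, ← congrFun hv' e, map_mul, AlgHom.commutes,
          map_cycleVarInv, hφ, haF, map_mul, mul_comm (ι _), mul_assoc, mul_inv_cancel₀ h0.1,
          mul_one]) i 0
    rwa [hv0, map_zero, sub_zero] at this
  have hφψ : ∀ d, φ (ψ d) = ι (τ d) := by
    have : (φ : B →+* F).comp ψ = ι.comp τ := by
      refine MvPolynomial.ringHom_ext (fun z => ?_) fun o => ?_
      · change φ (ψ (MvPolynomial.C z)) = ι (τ (MvPolynomial.C z))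
        rw [hψC]
        refine (φ.commutes _).trans ((hKF _).trans (congrArg ι ?_))
        exact ((paramMap G h12).commutes z).trans (hτC z).symm
      · rcases o with _ | ⟨_ | _, i⟩
        · change φ (ψ γ) = ι (τ γ)
          rw [hψγ, AlgHom.commutes]
          exact (hKF _).trans (congrArg ι (hpc0.trans hτγ.symm))
        · change φ (ψ (v i)) = ι (τ (v i))
          rw [hτv, map_sub, hψv, hφv]
        · change φ (ψ (u i)) = ι (τ (u i))
          rw [hτu, map_sub, hψu, hφu]
    exact fun d => congrArg (fun g => g d) this
  have hfrac : ∀ b : B, ∃ w d : D, IsUnit (ψ w) ∧ ψ w * b = ψ d := by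
    have hunit : ∀ e, IsUnit (cycleVar e : B) := fun e =>
      IsUnit.of_mul_eq_one _ (cycleVar_mul_cycleVarInv e)
    intro b
    have hb : b ∈ Algebra.adjoin K (Set.range (cycleVar : _ → B) ∪ Set.range cycleVarInv) := by
      rw [adjoin_cycleVar]; trivial
    induction hb using Algebra.adjoin_induction with
    | mem x hx =>
      rcases hx with ⟨e, rfl⟩ | ⟨e, rfl⟩
      · exact ⟨1, edgeDiff u e, by simp, by rw [map_one, one_mul, hψu']⟩
      · exact ⟨edgeDiff u e, 1, by rw [hψu']; exact hunit e, by
          rw [hψu', cycleVar_mul_cycleVarInv, map_one]⟩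
    | algebraMap x =>
      obtain ⟨r, s, hs, rfl⟩ := IsFractionRing.div_surjective (A := R) x
      have hs0 : algebraMap R K s ≠ 0 :=
        (map_ne_zero_iff _ (IsFractionRing.injective R K)).mpr (nonZeroDivisors.ne_zero hs)
      refine ⟨paramMap G h12 s, paramMap G h12 r, ?_, ?_⟩
      · rw [hψθ]; exact (IsUnit.mk0 _ hs0).map (algebraMap K B)
      · rw [hψθ, hψθ]
        exact (map_mul (algebraMap K B) _ _).symm.trans
          (congrArg (algebraMap K B) (mul_div_cancel₀ _ hs0))
    | add x y _ _ hx hy =>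
      obtain ⟨w, d, hw, hd⟩ := hx
      obtain ⟨w', d', hw', hd'⟩ := hy
      refine ⟨w * w', d * w' + w * d', by rw [map_mul]; exact hw.mul hw', ?_⟩
      simp only [map_mul, map_add, ← hd, ← hd']
      ring
    | mul x y _ _ hx hy =>
      obtain ⟨w, d, hw, hd⟩ := hx
      obtain ⟨w', d', hw', hd'⟩ := hy
      refine ⟨w * w', d * d', by rw [map_mul]; exact hw.mul hw', ?_⟩
      simp only [map_mul, ← hd, ← hd']
      ring
  have hinj : Function.Injective φ := by
    refine (injective_iff_map_eq_zero _).mpr fun b hb => ?_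
    obtain ⟨w, d, hw, hd⟩ := hfrac b
    have h1 : ι (τ d) = 0 := by rw [← hφψ, ← hd, map_mul, hb, mul_zero]
    have h2 : τ d = 0 := hι (h1.trans (map_zero ι).symm)
    have h3 : ψ d = 0 := by rw [← hψτ, h2, map_zero]
    exact hw.mul_right_eq_zero.mp (hd.trans h3)
  exact hinj.isDomain φ.toRingHom

/-- The generic cycle system has `4 c₂(G)` solutions, counted by the dimension of its coordinate
ring. -/
theorem finrank_cycleRing {n : ℕ} [NeZero n] (hn : 3 ≤ n) {G : SimpleGraph (Fin n)}
    (h12 : G.Adj 0 1) (hG : IsMinimallyRigidGraph G 2) {c : ℕ} (hc : IsRealisationNumber G 2 c)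
    {K : Type} [Field K] [Algebra (MvPolynomial (G.edgeSet ⊕ Fin 2) ℂ) K]
    [IsFractionRing (MvPolynomial (G.edgeSet ⊕ Fin 2) ℂ) K] :
    Module.finrank K (CycleRing G h12
      (fun e => algebraMap (MvPolynomial (G.edgeSet ⊕ Fin 2) ℂ) K (MvPolynomial.X (Sum.inl e)))
      fun j => algebraMap (MvPolynomial (G.edgeSet ⊕ Fin 2) ℂ) K (MvPolynomial.X (Sum.inr j))) =
      4 * c := by
  have := charZero_of_injective_algebraMap
    (IsFractionRing.injective (MvPolynomial (G.edgeSet ⊕ Fin 2) ℂ) K)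
  have hdom := isDomain_cycleRing h12 hG (K := K)
  have hind := algebraicIndependent_algebraMap_X (G.edgeSet ⊕ Fin 2) (K := K)
    (k := AlgebraicClosure K)
  have hsol := card_cycleSolutions_of_algebraicIndependent hn h12 hG hc
    (mk_of_isFractionRing_of_isAlgebraic (G.edgeSet ⊕ Fin 2) (K := K)) hind
  have hcard := (card_cycleRing_algHom h12 (K := K) _ _ (AlgebraicClosure K)).trans hsol
  have := Nat.finite_of_card_ne_zero
    (hcard.trans_ne (Nat.mul_ne_zero four_ne_zero hc.1.ne'))
  exact finrank_eq_card_algHom.trans hcard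

/-- For a minimally 2-rigid graph `G` with `n ≥ 3` labelled so that
`12 ∈ E`, the generic root count of the system `I''_E` (cycle polynomials
`∑ y_{ij}` and `∑ a_{ij} y_{ij}⁻¹`, together with `c₁ y₁₂² + c₂`) equals `4·c₂(G)`. -/
theorem statement_14 {n : ℕ} [NeZero n] (hn : 3 ≤ n)
    (G : SimpleGraph (Fin n)) (h12 : G.Adj 0 1)
    (hG : IsMinimallyRigidGraph G 2)
    (c : ℕ) (hc : IsRealisationNumber G 2 c) :
    Module.finrank (RatFuncField (↥G.edgeSet ⊕ Fin 2))
      (LaurentRing (RatFuncField (↥G.edgeSet ⊕ Fin 2)) ↥G.edgeSet ⧸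
        Ideal.span (
          {g : LaurentRing (RatFuncField (↥G.edgeSet ⊕ Fin 2)) ↥G.edgeSet |
            ∃ (v : Fin n) (w : G.Walk v v), w.IsCycle ∧
              g = (w.darts.map fun dd =>
                ydirE (RatFuncField (↥G.edgeSet ⊕ Fin 2)) dd).sum} ∪
          {g : LaurentRing (RatFuncField (↥G.edgeSet ⊕ Fin 2)) ↥G.edgeSet |
            ∃ (v : Fin n) (w : G.Walk v v), w.IsCycle ∧
              g = (w.darts.map fun dd =>
                algebraMap _ _
                    (ratParam (P := ↥G.edgeSet ⊕ Fin 2) (Sum.inl (⟨dd.edge, dd.edge_mem⟩ : ↥G.edgeSet))) *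
                  ydirEinv (RatFuncField (↥G.edgeSet ⊕ Fin 2)) dd).sum} ∪
          {g : LaurentRing (RatFuncField (↥G.edgeSet ⊕ Fin 2)) ↥G.edgeSet |
            g = algebraMap _ _ (ratParam (P := ↥G.edgeSet ⊕ Fin 2) (Sum.inr (0 : Fin 2))) *
                  (LX (⟨s(0, 1), G.mem_edgeSet.mpr h12⟩ : ↥G.edgeSet)) ^ 2 +
                algebraMap _ _ (ratParam (P := ↥G.edgeSet ⊕ Fin 2) (Sum.inr (1 : Fin 2)))})) =
      4 * c := by
  exact finrank_cycleRing hn h12 hG hc (K := RatFuncField (G.edgeSet ⊕ Fin 2))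

end PaperDefs
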